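/- arXiv:1305.5121 — 9 statements merged into one kernel-verified Lean document; each statement's English description precedes it below -/
import Mathlib

section
/- Let F = 𝔽_q be a finite field of odd characteristic and let L be a quadratic field extension of F, written L = F[T]/(T² − c) for some c ∈ F^×, with nontrivial automorphism σ. For a ∈ L \ F let A_a = (L/F, σ, a). If a = kT for some k ∈ F^×, then the group of F-algebra automorphisms of A_a is isomorphic to the dicyclic group of order 2(q+1) (the group ⟨x, y | y^{q+1} = 1, x² = y^{(q+1)/2}, x^{−1} y x = y^{−1}⟩). Otherwise, the group of F-algebra automorphisms of A_a is cyclic of order q+1. -/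
noncomputable section

/-- Multiplication of the nonassociative cyclic algebra `(L/F, σ, a)` of degree `n`. -/
def cycMul {F L : Type*} [Field F] [Field L] [Algebra F L] (n : ℕ)
    (σ : L ≃ₐ[F] L) (a : L) (x y : Fin n → L) : Fin n → L :=
  fun k => ∑ i : Fin n, ∑ j : Fin n,
    if (i : ℕ) + (j : ℕ) = (k : ℕ) then x i * (σ ^ (i : ℕ)) (y j)
    else if (i : ℕ) + (j : ℕ) = (k : ℕ) + n then x i * (σ ^ (i : ℕ)) (y j) * a
    else 0

/-- The unit element `1 = z^0` of `(L/F, σ, a)`. -/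
def cycOne (L : Type*) [Field L] (n : ℕ) : Fin n → L :=
  fun k => if (k : ℕ) = 0 then 1 else 0


/-- The automorphism group (as a subgroup of the group of `F`-linear self-equivalences)
of a not-necessarily-associative algebra given by a multiplication `mul` and unit `one`
on an `F`-vector space `M`. -/
def ntAut (F M : Type*) [Field F] [AddCommGroup M] [Module F M]
    (mul : M → M → M) (one : M) : Subgroup (M ≃ₗ[F] M) where
  carrier := {e | (∀ x y : M, e (mul x y) = mul (e x) (e y)) ∧ e one = one}
  one_mem' := ⟨fun _ _ => rfl, rfl⟩
  mul_mem' := by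
    rintro e f ⟨he, he1⟩ ⟨hf, hf1⟩
    refine ⟨fun x y => ?_, ?_⟩
    · show e (f (mul x y)) = mul (e (f x)) (e (f y))
      rw [hf, he]
    · show e (f one) = one
      rw [hf1, he1]
  inv_mem' := by
    rintro e ⟨he, he1⟩
    refine ⟨fun x y => ?_, ?_⟩
    · apply e.injective
      show e (e.symm (mul x y)) = e (mul (e.symm x) (e.symm y))
      rw [e.apply_symm_apply, he, e.apply_symm_apply, e.apply_symm_apply]
    · apply e.injective
      show e (e.symm one) = e one
      rw [e.apply_symm_apply, he1]

section Dicyclic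

variable {G : Type*} [Group G]

/-- A group containing elements satisfying the defining relations of the dicyclic group, generated
by them in the strong sense that the cyclic part has index two, is dicyclic. -/
theorem nonempty_mulEquiv_quaternionGroup {m : ℕ} {x y : G} (hy : orderOf y = 2 * m)
    (hx : x * x = y ^ m) (hxy : y * x = x * y⁻¹) (hxmem : x ∉ Subgroup.zpowers y)
    (hgen : ∀ g : G, g ∈ Subgroup.zpowers y ∨ ∃ h ∈ Subgroup.zpowers y, g = x * h) :
    Nonempty (G ≃* QuaternionGroup m) := by
  have hpow (i : ZMod (2 * m)) : ∃ k : ℤ, (k : ZMod (2 * m)) = i := ZMod.intCast_surjective i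
  choose r hr using hpow
  let f : ZMod (2 * m) → G := fun i => y ^ r i
  have hf (k : ℤ) : f k = y ^ k := by
    rw [zpow_eq_zpow_iff_modEq, hy]
    have := (ZMod.intCast_eq_intCast_iff _ _ _).1 (hr k)
    exact_mod_cast this
  have hadd (i j) : f (i + j) = f i * f j := by
    rw [← hr i, ← hr j, ← Int.cast_add, hf, hf, hf, zpow_add]
  have hsub (i j) : f (i - j) = f i * (f j)⁻¹ := by
    rw [← hr i, ← hr j, ← Int.cast_sub, hf, hf, hf, zpow_sub]
  have hm : f m = y ^ m := by simpa using hf m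
  have hcomm (i) : f i * x = x * (f i)⁻¹ := by
    have h : SemiconjBy x y⁻¹ y := hxy.symm
    have := (h.zpow_right (r i)).eq
    simpa only [f, inv_zpow] using this.symm
  have hff (i j) : Commute (f i) (f j) := Commute.zpow_zpow_self y _ _
  have hinj (i j) (h : f i = f j) : i = j := by
    rw [zpow_eq_zpow_iff_modEq, hy] at h
    rw [← hr i, ← hr j, ZMod.intCast_eq_intCast_iff]
    exact_mod_cast h
  have hmem (i) : f i ∈ Subgroup.zpowers y := ⟨r i, rfl⟩
  let φ : QuaternionGroup m → G
    | .a i => f i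
    | .xa i => x * f i
  have hmul (g h) : φ (g * h) = φ g * φ h := by
    rcases g with i | i <;> rcases h with j | j
    · exact hadd i j
    · change x * f (j - i) = f i * (x * f j)
      rw [← mul_assoc, hcomm, hsub, mul_assoc, ((hff j i).inv_right).eq]
    · change x * f (i + j) = x * f i * f j
      rw [hadd, mul_assoc]
    · change f (m + j - i) = x * f i * (x * f j)
      rw [mul_assoc, ← mul_assoc (f i), hcomm, hsub, hadd, hm, ← hx]
      simp only [mul_assoc, ((hff j i).inv_right).eq]
  refine ⟨(MulEquiv.ofBijective (MonoidHom.mk' φ hmul) ⟨?_, ?_⟩).symm⟩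
  · have hne (i j) : f i ≠ x * f j := fun h => hxmem <| by
      rw [← Subgroup.mul_mem_cancel_right _ (hmem j), ← h]
      exact hmem i
    rintro (i | i) (j | j) h
    · exact congrArg _ (hinj _ _ h)
    · exact (hne _ _ h).elim
    · exact (hne _ _ h.symm).elim
    · exact congrArg _ (hinj _ _ (mul_left_cancel h))
  · intro g
    rcases hgen g with ⟨k, rfl⟩ | ⟨_, ⟨k, rfl⟩, rfl⟩
    · exact ⟨.a k, hf k⟩
    · exact ⟨.xa k, congrArg (x * ·) (hf k)⟩

end Dicyclic

section Quadratic

variable {F L : Type*} [Field F] [Field L] [Algebra F L] {σ : L ≃ₐ[F] L} {a : L}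

theorem cycMul_two_zero (x y : Fin 2 → L) :
    cycMul 2 σ a x y 0 = x 0 * y 0 + x 1 * σ (y 1) * a := by
  simp [cycMul, Fin.sum_univ_two]

theorem cycMul_two_one (x y : Fin 2 → L) :
    cycMul 2 σ a x y 1 = x 0 * y 1 + x 1 * σ (y 0) := by
  simp [cycMul, Fin.sum_univ_two]

theorem cycOne_two : cycOne L 2 = ![1, 0] := by
  ext i; fin_cases i <;> simp [cycOne]

theorem cycMul_two (u v x y : L) :
    cycMul 2 σ a ![u, v] ![x, y] = ![u * x + v * σ y * a, u * y + v * σ x] := by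
  ext i; fin_cases i
  · exact cycMul_two_zero _ _
  · exact cycMul_two_one _ _

/-- The middle nucleus of a nonassociative quaternion algebra is `L`. -/
theorem cycMul_two_middle_assoc_iff (ha : σ a ≠ a) (w : Fin 2 → L) :
    (∀ p r, cycMul 2 σ a (cycMul 2 σ a p w) r = cycMul 2 σ a p (cycMul 2 σ a w r)) ↔
      w 1 = 0 := by
  constructor
  · intro h
    have := congrFun (h ![0, 1] ![0, 1]) 1
    simp only [cycMul_two_zero, cycMul_two_one, Matrix.cons_val_zero, Matrix.cons_val_one,
      map_zero, map_one, map_mul, zero_mul, mul_zero, mul_one, one_mul, zero_add,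
      add_zero] at this
    by_contra hw
    exact ha (mul_left_cancel₀ ((map_ne_zero σ).2 hw) this).symm
  · intro h p r
    ext i; fin_cases i <;>
    · simp only [Fin.zero_eta, Fin.mk_one, cycMul_two_zero, cycMul_two_one, h, map_zero, map_mul,
        map_add]
      ring

/-- The map `x + y z ↦ τ(x) + β τ(y) z`. -/
def diagEquiv (τ : L ≃ₐ[F] L) (β : Lˣ) : (Fin 2 → L) ≃ₗ[F] (Fin 2 → L) where
  toFun v := ![τ (v 0), β * τ (v 1)]
  map_add' v w := by ext i; fin_cases i <;> simp [mul_add]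
  map_smul' r v := by ext i; fin_cases i <;> simp
  invFun v := ![τ.symm (v 0), τ.symm ((β⁻¹ : Lˣ) * v 1)]
  left_inv v := by ext i; fin_cases i <;> simp
  right_inv v := by ext i; fin_cases i <;> simp

theorem diagEquiv_apply (τ : L ≃ₐ[F] L) (β : Lˣ) (v : Fin 2 → L) :
    diagEquiv τ β v = ![τ (v 0), β * τ (v 1)] := rfl

theorem diagEquiv_mul (τ τ' : L ≃ₐ[F] L) (β β' : Lˣ) :
    diagEquiv τ β * diagEquiv τ' β' =
      diagEquiv (τ * τ') (β * Units.map (τ : L →* L) β') := by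
  ext v i
  fin_cases i <;> simp [diagEquiv_apply, mul_assoc]

theorem diagEquiv_injective {τ τ' : L ≃ₐ[F] L} {β β' : Lˣ}
    (h : diagEquiv τ β = diagEquiv τ' β') : τ = τ' ∧ β = β' := by
  refine ⟨AlgEquiv.ext fun l => ?_, Units.ext ?_⟩
  · simpa [diagEquiv_apply] using congrFun (DFunLike.congr_fun h ![l, 0]) 0
  · simpa [diagEquiv_apply] using congrFun (DFunLike.congr_fun h ![0, 1]) 1

theorem diagEquiv_mem_ntAut {τ : L ≃ₐ[F] L} {β : Lˣ} (hcomm : ∀ l, τ (σ l) = σ (τ l))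
    (h : τ a = β * σ β * a) :
    diagEquiv τ β ∈ ntAut F (Fin 2 → L) (cycMul 2 σ a) (cycOne L 2) := by
  refine ⟨fun x y => ?_, ?_⟩
  · ext i; fin_cases i <;>
    · simp only [Fin.zero_eta, Fin.mk_one, diagEquiv_apply, cycMul_two_zero, cycMul_two_one,
        Matrix.cons_val_zero, Matrix.cons_val_one, map_add, map_mul, hcomm, h]
      ring
  · simp [cycOne_two, diagEquiv_apply]

/-- Every automorphism of a nonassociative quaternion algebra is diagonal. -/
theorem exists_eq_diagEquiv_of_mem_ntAut (ha : σ a ≠ a) {e : (Fin 2 → L) ≃ₗ[F] (Fin 2 → L)}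
    (he : e ∈ ntAut F (Fin 2 → L) (cycMul 2 σ a) (cycOne L 2)) :
    ∃ (τ : L ≃ₐ[F] L) (β : Lˣ), τ a = β * σ β * a ∧ e = diagEquiv τ β := by
  have hL {e : (Fin 2 → L) ≃ₗ[F] (Fin 2 → L)}
      (he : e ∈ ntAut F (Fin 2 → L) (cycMul 2 σ a) (cycOne L 2)) (l : L) :
      e ![l, 0] = ![e ![l, 0] 0, 0] := by
    have h : e ![l, 0] 1 = 0 := by
      rw [← cycMul_two_middle_assoc_iff ha]
      intro p r
      obtain ⟨p, rfl⟩ := e.surjective p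
      obtain ⟨r, rfl⟩ := e.surjective r
      simp only [← he.1]
      rw [(cycMul_two_middle_assoc_iff ha _).2 (by simp)]
    ext i; fin_cases i
    · rfl
    · exact h
  have he' := inv_mem he
  have hL' := hL he'
  replace hL := hL he
  let τ : L ≃ₐ[F] L :=
    { toFun := fun l => e ![l, 0] 0
      invFun := fun l => e⁻¹ ![l, 0] 0
      left_inv := fun l => by
        change e⁻¹ ![e ![l, 0] 0, 0] 0 = l
        rw [← hL]
        exact congrFun (e.symm_apply_apply _) 0
      right_inv := fun l => by
        change e ![e⁻¹ ![l, 0] 0, 0] 0 = l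
        rw [← hL']
        exact congrFun (e.apply_symm_apply _) 0
      map_mul' := fun l m => by
        have h := he.1 ![l, 0] ![m, 0]
        rw [cycMul_two, hL l, hL m, cycMul_two] at h
        simpa using congrFun h 0
      map_add' := fun l m => by
        rw [← Pi.add_apply, ← map_add]
        simp
      commutes' := fun r => by
        have h : (![algebraMap F L r, 0] : Fin 2 → L) = r • cycOne L 2 := by
          ext i; fin_cases i <;> simp [cycOne_two, Algebra.algebraMap_eq_smul_one]
        rw [h, map_smul, he.2]
        simp [cycOne_two, Algebra.algebraMap_eq_smul_one] }
  have hτ (l : L) : e ![l, 0] = ![τ l, 0] := hL l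
  obtain ⟨α, β, hz⟩ : ∃ α β : L, e ![0, 1] = ![α, β] :=
    ⟨e ![0, 1] 0, e ![0, 1] 1, by ext i; fin_cases i <;> rfl⟩
  have hlz (l : L) : e ![0, l] = ![τ l * α, τ l * β] := by
    have h := he.1 ![l, 0] ![0, 1]
    rw [hz, hτ, cycMul_two, cycMul_two] at h
    simpa using h
  have hα : α = 0 := by
    have h := he.1 ![0, 1] ![a, 0]
    rw [hz, hτ, cycMul_two, cycMul_two] at h
    simp only [zero_mul, one_mul, map_zero, mul_zero, add_zero, zero_add, hlz] at h
    have h0 : τ (σ a) * α = α * τ a := congrFun h 0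
    by_contra hα
    rw [mul_comm] at h0
    exact ha (τ.injective (mul_left_cancel₀ hα h0))
  subst hα
  have hβ : β ≠ 0 := by
    rintro rfl
    have : (![0, 1] : Fin 2 → L) = 0 := e.injective (by rw [hz, map_zero]; simp)
    simpa using congrFun this 1
  refine ⟨τ, Units.mk0 β hβ, ?_, ?_⟩
  · have h := he.1 ![0, 1] ![0, 1]
    rw [hz, cycMul_two, cycMul_two] at h
    simp only [zero_mul, one_mul, map_zero, mul_zero, add_zero, zero_add, map_one, hτ] at h
    exact congrFun h 0
  · refine LinearEquiv.ext fun v => ?_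
    have hv : v = ![v 0, 0] + ![0, v 1] := by ext i; fin_cases i <;> simp
    rw [hv, map_add, hτ, hlz, diagEquiv_apply]
    ext i; fin_cases i <;> simp [mul_comm]

end Quadratic

section Finite

variable {F L : Type*} [Field F] [Fintype F] [Field L] [Algebra F L]

/-- The Galois group of a quadratic extension of a finite field consists of the identity and the
Frobenius. -/
theorem algEquiv_eq_one_or_apply_eq_pow_card (hrank : Module.finrank F L = 2) (τ : L ≃ₐ[F] L) :
    τ = 1 ∨ ∀ l, τ l = l ^ Fintype.card F := by
  have : FiniteDimensional F L := FiniteDimensional.of_finrank_pos (by omega)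
  have : Finite L := Module.finite_of_finite F
  obtain ⟨⟨i, hi⟩, rfl⟩ := (FiniteField.bijective_frobeniusAlgEquivOfAlgebraic_pow F L).2 τ
  rw [hrank] at hi
  interval_cases i
  · exact Or.inl (pow_zero _)
  · exact Or.inr fun l => by simp

theorem exists_isPrimitiveRoot_units (hrank : Module.finrank F L = 2) :
    ∃ g : Lˣ, IsPrimitiveRoot g ((Fintype.card F - 1) * (Fintype.card F + 1)) := by
  have : FiniteDimensional F L := FiniteDimensional.of_finrank_pos (by omega)
  have : Finite L := Module.finite_of_finite F
  obtain ⟨g, hg⟩ := IsCyclic.exists_generator (α := Lˣ)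
  refine ⟨g, ?_⟩
  have h : Nat.card L = Fintype.card F ^ 2 := by
    rw [Module.natCard_eq_pow_finrank (K := F), hrank, Nat.card_eq_fintype_card]
  have h2 : (Fintype.card F - 1) * (Fintype.card F + 1) = orderOf g := by
    rw [orderOf_eq_card_of_forall_mem_zpowers hg, Nat.card_units, h, mul_comm,
      ← Nat.sq_sub_sq, one_pow]
  rw [h2]
  exact IsPrimitiveRoot.orderOf g

end Finite

/-- let `F = 𝔽_q` of odd characteristic, `L = F[T]/(T² - c)` a quadratic
extension of `F` with nontrivial automorphism `σ`, and for `a ∈ L \ F` let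
`A_a = (L/F, σ, a)`.  If `a = kT` with `k ∈ Fˣ` then `Aut(A_a)` is the dicyclic group
of order `2(q+1)` (i.e. `QuaternionGroup ((q+1)/2)`); otherwise `Aut(A_a)` is cyclic of
order `q + 1`. -/
theorem sandler_aut_quadratic
    {F L : Type*} [Field F] [Fintype F] [Field L] [Algebra F L] [IsGalois F L]
    (q : ℕ) (hq : Fintype.card F = q) (hchar : ringChar F ≠ 2)
    (hrank : Module.finrank F L = 2)
    (c : F) (hc : c ≠ 0) (T : L) (hT : T ^ 2 = algebraMap F L c)
    (hTF : T ∉ Set.range (algebraMap F L))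
    (σ : L ≃ₐ[F] L) (hσ : σ ≠ 1)
    (a : L) (ha : a ∉ Set.range (algebraMap F L)) :
    ((∃ k : F, k ≠ 0 ∧ a = algebraMap F L k * T) →
      Nonempty (↥(ntAut F (Fin 2 → L) (cycMul 2 σ a) (cycOne L 2)) ≃*
        QuaternionGroup ((q + 1) / 2))) ∧
    ((¬ ∃ k : F, k ≠ 0 ∧ a = algebraMap F L k * T) →
      Nonempty (↥(ntAut F (Fin 2 → L) (cycMul 2 σ a) (cycOne L 2)) ≃*
        Multiplicative (ZMod (q + 1)))) := by
  subst hq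
  have hfin : FiniteDimensional F L := FiniteDimensional.of_finrank_pos (by omega)
  have hfrob : ∀ l, σ l = l ^ Fintype.card F :=
    (algEquiv_eq_one_or_apply_eq_pow_card hrank σ).resolve_left hσ
  have hgal (τ : L ≃ₐ[F] L) : τ = 1 ∨ τ = σ :=
    (algEquiv_eq_one_or_apply_eq_pow_card hrank τ).imp_right
      fun h => AlgEquiv.ext fun l => (h l).trans (hfrob l).symm
  have hσσ' : σ * σ = 1 := (hgal _).resolve_right fun h => hσ (mul_eq_left.1 h)
  have hσσ (l : L) : σ (σ l) = l := DFunLike.congr_fun hσσ' l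
  have hfix {l : L} (h : σ l = l) : l ∈ Set.range (algebraMap F L) := by
    rw [IsGalois.mem_range_algebraMap_iff_fixed]
    intro τ
    rcases hgal τ with rfl | rfl
    · rfl
    · exact h
  have hσa : σ a ≠ a := fun h => ha (hfix h)
  have hT0 : T ≠ 0 := fun h => hTF ⟨0, by simp [h]⟩
  have ha0 : a ≠ 0 := fun h => ha ⟨0, by simp [h]⟩
  have hσT : σ T = -T := by
    have h : σ T ^ 2 = T ^ 2 := by rw [← map_pow, hT, AlgEquiv.commutes]
    exact (sq_eq_sq_iff_eq_or_eq_neg.1 h).resolve_left fun h => hTF (hfix h)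
  have hanti : σ a = -a ↔ ∃ k : F, k ≠ 0 ∧ a = algebraMap F L k * T := by
    constructor
    · intro h
      obtain ⟨k, hk⟩ := hfix (l := a / T) (by rw [map_div₀, h, hσT, neg_div_neg_eq])
      have hk' : a = algebraMap F L k * T := by rw [hk, div_mul_cancel₀ _ hT0]
      refine ⟨k, ?_, hk'⟩
      rintro rfl
      exact ha0 (by simp [hk'])
    · rintro ⟨k, -, rfl⟩
      rw [map_mul, AlgEquiv.commutes, hσT, mul_neg]
  have hnorm (β : Lˣ) : (β : L) * σ β = (β ^ (Fintype.card F + 1) : Lˣ) := by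
    rw [hfrob, pow_succ', Units.val_mul, Units.val_pow_eq_pow_val]
  have hmem1 {β : Lˣ} (hβ : β ^ (Fintype.card F + 1) = 1) :
      diagEquiv (1 : L ≃ₐ[F] L) β ∈ ntAut F (Fin 2 → L) (cycMul 2 σ a) (cycOne L 2) :=
    diagEquiv_mem_ntAut (fun _ => rfl) (by simp [hnorm, hβ])
  let ι : rootsOfUnity (Fintype.card F + 1) L →*
      ntAut F (Fin 2 → L) (cycMul 2 σ a) (cycOne L 2) :=
    MonoidHom.mk' (fun u => ⟨diagEquiv 1 u.1, hmem1 u.2⟩) fun u v => Subtype.ext <| by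
      refine Eq.trans ?_ (diagEquiv_mul _ _ _ _).symm
      congr 1
  have hι : Function.Injective ι := fun u v h =>
    Subtype.ext (diagEquiv_injective (congrArg Subtype.val h)).2
  have hcase (e : ntAut F (Fin 2 → L) (cycMul 2 σ a) (cycOne L 2)) :
      e ∈ ι.range ∨ (σ a = -a ∧ ∃ β : Lˣ, e.1 = diagEquiv σ β ∧
        β ^ (Fintype.card F + 1) = -1) := by
    obtain ⟨τ, β, hβ, he⟩ := exists_eq_diagEquiv_of_mem_ntAut hσa e.2
    rw [hnorm] at hβ
    rcases hgal τ with rfl | rfl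
    · refine Or.inl ⟨⟨β, ?_⟩, Subtype.ext he.symm⟩
      rw [AlgEquiv.one_apply, right_eq_mul₀ ha0] at hβ
      exact Units.ext hβ
    · have hsq : ((β ^ (Fintype.card F + 1) : Lˣ) : L) ^ 2 = 1 := by
        have h := congrArg τ hβ
        rw [hσσ, map_mul, hβ, ← mul_assoc, right_eq_mul₀ ha0, ← hnorm, map_mul, hσσ,
          mul_comm (τ (β : L)), ← sq, hnorm] at h
        exact h
      rcases sq_eq_one_iff.1 hsq with h | h
      · rw [h, one_mul] at hβ
        exact (hσa hβ).elim
      · refine Or.inr ⟨by rw [hβ, h, neg_one_mul], β, he, Units.ext h⟩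
  obtain ⟨g, hg⟩ := exists_isPrimitiveRoot_units (F := F) (L := L) hrank
  have hcard : 1 < Fintype.card F := Fintype.one_lt_card
  have hζ : IsPrimitiveRoot (g ^ (Fintype.card F - 1)) (Fintype.card F + 1) :=
    hg.pow (Nat.mul_pos (by omega) (by omega)) rfl
  constructor
  · intro h
    rw [← hanti] at h
    have hodd := FiniteField.odd_card_of_char_ne_two hchar
    obtain ⟨t, ht⟩ : ∃ t, Fintype.card F = 2 * t + 1 := ⟨Fintype.card F / 2, by omega⟩
    have hm : Fintype.card F + 1 = 2 * ((Fintype.card F + 1) / 2) := by omega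
    have hinv {e f : ntAut F (Fin 2 → L) (cycMul 2 σ a) (cycOne L 2)} {β γ : Lˣ}
        (he : e.1 = diagEquiv σ β) (hf : f.1 = diagEquiv σ γ) : e * f ∈ ι.range := by
      refine (hcase (e * f)).resolve_right ?_
      rintro ⟨-, δ, hδ, -⟩
      rw [Subgroup.coe_mul, he, hf, diagEquiv_mul, hσσ'] at hδ
      exact hσ (diagEquiv_injective hδ).1.symm
    let ζ : rootsOfUnity (Fintype.card F + 1) L := ⟨g ^ (Fintype.card F - 1), hζ.pow_eq_one⟩
    have hζu : (ζ : Lˣ) ^ (Fintype.card F + 1) = 1 := ζ.2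
    have hrange : Subgroup.zpowers (ι ζ) = ι.range := by
      rw [← MonoidHom.map_zpowers, MonoidHom.range_eq_map]
      congr 1
      refine (Subgroup.eq_top_iff' _).2 fun u => ?_
      obtain ⟨k, hk⟩ : (u : Lˣ) ∈ Subgroup.zpowers (ζ : Lˣ) := by
        rw [hζ.zpowers_eq]
        exact u.2
      exact ⟨k, Subtype.ext hk⟩
    have hhalf : (ζ : Lˣ) ^ ((Fintype.card F + 1) / 2) = -1 := by
      have h2 : IsPrimitiveRoot ((ζ : Lˣ) ^ ((Fintype.card F + 1) / 2)) 2 :=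
        hζ.pow (by omega) (by omega)
      exact Units.ext (IsPrimitiveRoot.coe_units_iff.2 h2).eq_neg_one_of_two_right
    obtain ⟨β, hβ⟩ : ∃ β : Lˣ, β ^ (Fintype.card F + 1) = -1 := by
      refine ⟨g ^ t, ?_⟩
      rw [← hhalf, ← pow_mul, ← pow_mul]
      congr 1
      rw [show (Fintype.card F + 1) / 2 = t + 1 by omega, ht, Nat.add_sub_cancel]
      ring
    have hβmem : diagEquiv σ β ∈ ntAut F (Fin 2 → L) (cycMul 2 σ a) (cycOne L 2) :=
      diagEquiv_mem_ntAut (fun _ => rfl) (by simp [hnorm, hβ, h])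
    have hmap (u : Lˣ) : Units.map (σ : L →* L) u = u ^ Fintype.card F :=
      Units.ext (by simp [hfrob])
    have hone (u : Lˣ) : Units.map ((1 : L ≃ₐ[F] L) : L →* L) u = u := Units.ext rfl
    refine nonempty_mulEquiv_quaternionGroup (x := ⟨_, hβmem⟩) (y := ι ζ) ?_ ?_ ?_ ?_ ?_
    · rw [orderOf_injective ι hι, ← hm, ← Subgroup.orderOf_coe]
      exact hζ.eq_orderOf.symm
    · rw [← map_pow]
      refine Subtype.ext ((diagEquiv_mul _ _ _ _).trans ?_)
      rw [hσσ', hmap, ← pow_succ', hβ, ← hhalf]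
      rfl
    · rw [← map_inv]
      refine Subtype.ext ((diagEquiv_mul _ _ _ _).trans (Eq.trans ?_ (diagEquiv_mul _ _ _ _).symm))
      rw [hmap, hone, one_mul, mul_one, mul_comm, InvMemClass.coe_inv, inv_pow,
        inv_eq_of_mul_eq_one_right ((pow_succ _ _).symm.trans hζu)]
    · rw [hrange]
      rintro ⟨u, hu⟩
      exact hσ (diagEquiv_injective (congrArg Subtype.val hu)).1.symm
    · intro e
      rw [hrange]
      refine (hcase e).imp_right ?_
      rintro ⟨-, γ, he, -⟩
      refine ⟨_, ?_, (mul_inv_cancel_left _ e).symm⟩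
      rw [← mul_mem_cancel_left (hinv (e := ⟨_, hβmem⟩) (f := ⟨_, hβmem⟩) rfl rfl), mul_assoc,
        mul_inv_cancel_left]
      exact hinv rfl he
  · intro h
    rw [← hanti] at h
    have hbij : Function.Bijective ι := ⟨hι, fun e => (hcase e).resolve_right fun h' => h h'.1⟩
    refine ⟨(MulEquiv.ofBijective ι hbij).symm.trans (mulEquivOfCyclicCardEq ?_)⟩
    rw [hζ.card_rootsOfUnity']
    simp
end
end

section
/- Let F be a field, L/F a finite separable field extension, σ a nontrivial F-automorphism of L, and η, μ ∈ L. Each of the four algebras Kn1(L,σ,η,μ), Kn2(L,σ,η,μ), Kn3(L,σ,η,μ) and HK(L,σ,η,μ) is a division algebra (i.e. xy = 0 implies x = 0 or y = 0) if and only if the equation w σ(w) + μ w − η = 0 has no solution w ∈ L. -/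
variable {F L : Type*} [Field F] [Field L] [Algebra F L]

/-- Knuth's first multiplication `Kn₁` on `L ⊕ L`:
`(x,y)(u,v) = (xu + η σ(v) σ⁻²(y), vx + y σ(u) + μ σ(v) σ⁻¹(y))`. -/
def Kn1mul (σ : L ≃ₐ[F] L) (η μ : L) (p q : L × L) : L × L :=
  (p.1 * q.1 + η * σ q.2 * σ⁻¹ (σ⁻¹ p.2),
   q.2 * p.1 + p.2 * σ q.1 + μ * σ q.2 * σ⁻¹ p.2)

/-- Knuth's second multiplication `Kn₂` on `L ⊕ L`:
`(x,y)(u,v) = (xu + η σ⁻¹(v) σ⁻²(y), vx + y σ(u) + μ v σ⁻¹(y))`. -/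
def Kn2mul (σ : L ≃ₐ[F] L) (η μ : L) (p q : L × L) : L × L :=
  (p.1 * q.1 + η * σ⁻¹ q.2 * σ⁻¹ (σ⁻¹ p.2),
   q.2 * p.1 + p.2 * σ q.1 + μ * q.2 * σ⁻¹ p.2)

/-- Knuth's third multiplication `Kn₃` on `L ⊕ L`:
`(x,y)(u,v) = (xu + η σ⁻¹(v) y, vx + y σ(u) + μ v y)`. -/
def Kn3mul (σ : L ≃ₐ[F] L) (η μ : L) (p q : L × L) : L × L :=
  (p.1 * q.1 + η * σ⁻¹ q.2 * p.2,
   q.2 * p.1 + p.2 * σ q.1 + μ * q.2 * p.2)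

/-- The Hughes-Kleinfeld multiplication `HK` on `L ⊕ L`:
`(x,y)(u,v) = (xu + η σ(v) y, vx + y σ(u) + μ σ(v) y)`. -/
def HKmul (σ : L ≃ₐ[F] L) (η μ : L) (p q : L × L) : L × L :=
  (p.1 * q.1 + η * σ q.2 * p.2,
   q.2 * p.1 + p.2 * σ q.1 + μ * σ q.2 * p.2)

/-- A multiplication `(x,y)(u,v) = (xu + η A(v,y), vx + y σ(u) + μ C(v,y))` whose twists `A` and `C`
are related by a scaling factor `k` has no zero divisors iff `w σ(w) + μ w = η` has no solution. -/
theorem forall_eq_zero_or_eq_zero_iff_of_twist (σ : L ≃ₐ[F] L) (η μ : L) (A C : L → L → L)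
    (hA₁ : A 1 1 = 1) (hC₁ : C 1 1 = 1)
    (hC₀ : ∀ v, C v 0 = 0)
    (hA₀' : ∀ y, A 0 y = 0) (hC₀' : ∀ y, C 0 y = 0)
    (hk : ∀ v y, v ≠ 0 → y ≠ 0 → ∃ k, k * v * A v y = C v y ∧ σ k * C v y = y) :
    (∀ p q : L × L, (p.1 * q.1 + η * A q.2 p.2,
        q.2 * p.1 + p.2 * σ q.1 + μ * C q.2 p.2) = (0 : L × L) → p = 0 ∨ q = 0) ↔
      ¬ ∃ w : L, w * σ w + μ * w - η = 0 := by
  constructor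
  · rintro h ⟨w, hw⟩
    have := h (-(σ w + μ), 1) (w, 1) (by
      simp only [hA₁, hC₁, Prod.mk_eq_zero]
      exact ⟨by linear_combination -hw, by ring⟩)
    simp at this
  · rintro hw ⟨x, y⟩ ⟨u, v⟩ h
    simp only [Prod.mk_eq_zero] at h ⊢
    obtain ⟨h₁, h₂⟩ := h
    by_cases hv : v = 0
    · subst hv
      simp only [hA₀', hC₀', mul_zero, zero_mul, add_zero, zero_add, mul_eq_zero,
        map_eq_zero] at h₁ h₂
      tauto
    by_cases hy : y = 0
    · subst hy
      simp only [hC₀, mul_zero, zero_mul, add_zero, mul_eq_zero, hv, false_or] at h₂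
      exact .inl ⟨h₂, rfl⟩
    obtain ⟨k, hkA, hkC⟩ := hk v y hv hy
    have hA : A v y ≠ 0 := fun h0 ↦ hy (by rw [← hkC, ← hkA, h0, mul_zero, mul_zero])
    refine absurd ⟨k * u, mul_left_cancel₀ (mul_ne_zero hv hA) ?_⟩ hw
    rw [map_mul]
    linear_combination u * h₂ - v * h₁ + u * (σ k * σ u + μ) * hkA + u * σ u * hkC

/-- each of `Kn₁(L,σ,η,μ)`, `Kn₂(L,σ,η,μ)`, `Kn₃(L,σ,η,μ)` and
`HK(L,σ,η,μ)` is a division algebra if and only if the equation `w σ(w) + μ w - η = 0`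
has no solution `w ∈ L`. -/
theorem knuth_hughesKleinfeld_division_iff
    [FiniteDimensional F L] [Algebra.IsSeparable F L]
    (σ : L ≃ₐ[F] L) (hσ : σ ≠ 1) (η μ : L) :
    ((∀ p q : L × L, Kn1mul σ η μ p q = 0 → p = 0 ∨ q = 0) ↔
      ¬ ∃ w : L, w * σ w + μ * w - η = 0) ∧
    ((∀ p q : L × L, Kn2mul σ η μ p q = 0 → p = 0 ∨ q = 0) ↔
      ¬ ∃ w : L, w * σ w + μ * w - η = 0) ∧
    ((∀ p q : L × L, Kn3mul σ η μ p q = 0 → p = 0 ∨ q = 0) ↔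
      ¬ ∃ w : L, w * σ w + μ * w - η = 0) ∧
    ((∀ p q : L × L, HKmul σ η μ p q = 0 → p = 0 ∨ q = 0) ↔
      ¬ ∃ w : L, w * σ w + μ * w - η = 0) := by
  refine ⟨?_, ?_, ?_, ?_⟩
  · refine forall_eq_zero_or_eq_zero_iff_of_twist σ η μ (fun v y ↦ σ v * σ⁻¹ (σ⁻¹ y))
      (fun v y ↦ σ v * σ⁻¹ y) ?_ ?_ ?_ ?_ ?_ ?_ |> Iff.trans (by simp only [Kn1mul, mul_assoc])
    on_goal 6 =>
      intro v y hv hy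
      refine ⟨σ⁻¹ y / (v * σ⁻¹ (σ⁻¹ y)), ?_, ?_⟩
    all_goals simp
    all_goals field_simp [hv, hy]
  · refine forall_eq_zero_or_eq_zero_iff_of_twist σ η μ (fun v y ↦ σ⁻¹ v * σ⁻¹ (σ⁻¹ y))
      (fun v y ↦ v * σ⁻¹ y) ?_ ?_ ?_ ?_ ?_ ?_ |> Iff.trans (by simp only [Kn2mul, mul_assoc])
    on_goal 6 =>
      intro v y hv hy
      refine ⟨σ⁻¹ y / (σ⁻¹ v * σ⁻¹ (σ⁻¹ y)), ?_, ?_⟩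
    all_goals simp
    all_goals field_simp [hv, hy]
  · refine forall_eq_zero_or_eq_zero_iff_of_twist σ η μ (fun v y ↦ σ⁻¹ v * y)
      (fun v y ↦ v * y) ?_ ?_ ?_ ?_ ?_ ?_ |> Iff.trans (by simp only [Kn3mul, mul_assoc])
    on_goal 6 =>
      intro v y hv hy
      refine ⟨(σ⁻¹ v)⁻¹, ?_, ?_⟩
    all_goals simp
    all_goals field_simp [hv, hy]
  · refine forall_eq_zero_or_eq_zero_iff_of_twist σ η μ (fun v y ↦ σ v * y)
      (fun v y ↦ σ v * y) ?_ ?_ ?_ ?_ ?_ ?_ |> Iff.trans (by simp only [HKmul, mul_assoc])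
    on_goal 6 =>
      intro v y hv hy
      refine ⟨v⁻¹, ?_, ?_⟩
    all_goals simp [*]
end

section
/- Let A = Kn2(L, σ, η, μ) with η ≠ 0, and suppose that σ² ≠ Id or μ ≠ 0. Then the middle nucleus and the right nucleus of A are both equal to L ⊕ 0, while L ⊕ 0 is not contained in the left nucleus of A. -/
variable {F L : Type*} [Field F] [Field L] [Algebra F L]

/-- The associator `[a,b,c] = (ab)c - a(bc)` for a multiplication `mul`. -/
def assocOf {M : Type*} [AddCommGroup M] (mul : M → M → M) (a b c : M) : M :=
  mul (mul a b) c - mul a (mul b c)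

/-- The associator of `(x, 0)`, `(0, 1)` and an arbitrary element. -/
theorem assocOf_Kn2mul_left_inl (σ : L ≃ₐ[F] L) (η μ x : L) (c : L × L) :
    assocOf (Kn2mul σ η μ) (x, 0) (0, 1) c =
      (η * σ⁻¹ c.2 * (σ⁻¹ (σ⁻¹ x) - x), μ * c.2 * (σ⁻¹ x - x)) := by
  ext <;> simp [assocOf, Kn2mul] <;> ring

/-- The associator of `(x, 0)`, an arbitrary element and `(0, 1)`. -/
theorem assocOf_Kn2mul_left_inl_right (σ : L ≃ₐ[F] L) (η μ x : L) (b : L × L) :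
    assocOf (Kn2mul σ η μ) (x, 0) b (0, 1) =
      (η * σ⁻¹ (σ⁻¹ b.2) * (σ⁻¹ (σ⁻¹ x) - x), μ * σ⁻¹ b.2 * (σ⁻¹ x - x)) := by
  ext <;> simp [assocOf, Kn2mul] <;> ring

theorem assocOf_Kn2mul_middle_inl (σ : L ≃ₐ[F] L) (η μ u : L) (a c : L × L) :
    assocOf (Kn2mul σ η μ) a (u, 0) c = 0 := by
  ext <;> simp [assocOf, Kn2mul] <;> ring

theorem assocOf_Kn2mul_right_inl (σ : L ≃ₐ[F] L) (η μ w : L) (a b : L × L) :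
    assocOf (Kn2mul σ η μ) a b (w, 0) = 0 := by
  ext <;> simp [assocOf, Kn2mul] <;> ring

/-- If `σ ≠ 1` and (`σ ^ 2 ≠ 1` or `μ ≠ 0`), then the defects of `(x, 0)` from lying in the left
nucleus do not all vanish. -/
theorem exists_inv_apply_sub_ne_zero {σ : L ≃ₐ[F] L} (hσ : σ ≠ 1) {μ : L}
    (h : σ ^ 2 ≠ 1 ∨ μ ≠ 0) :
    ∃ x : L, σ⁻¹ (σ⁻¹ x) - x ≠ 0 ∨ μ ≠ 0 ∧ σ⁻¹ x - x ≠ 0 := by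
  rcases h with h | h
  · obtain ⟨x, hx⟩ : ∃ x, (σ ^ 2)⁻¹ x ≠ x := by
      simpa using mt AlgEquiv.ext (inv_ne_one.mpr h)
    refine ⟨x, Or.inl (sub_ne_zero.mpr ?_)⟩
    rwa [pow_two, mul_inv_rev, AlgEquiv.mul_apply] at hx
  · obtain ⟨x, hx⟩ : ∃ x, σ⁻¹ x ≠ x := by
      simpa using mt AlgEquiv.ext (inv_ne_one.mpr hσ)
    exact ⟨x, Or.inr ⟨h, sub_ne_zero.mpr hx⟩⟩

/-- for `A = Kn₂(L,σ,η,μ)` with `η ≠ 0` and (`σ² ≠ Id` or `μ ≠ 0`),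
the middle and right nuclei of `A` equal `L ⊕ 0`, while `L ⊕ 0` is not contained in
the left nucleus of `A`. -/
theorem kn2_nuclei
    [FiniteDimensional F L] [Algebra.IsSeparable F L]
    (σ : L ≃ₐ[F] L) (hσ : σ ≠ 1) (η μ : L) (hη : η ≠ 0)
    (h : σ ^ 2 ≠ 1 ∨ μ ≠ 0) :
    {b : L × L | ∀ a c : L × L, assocOf (Kn2mul σ η μ) a b c = 0}
        = {p : L × L | p.2 = 0} ∧
    {c : L × L | ∀ a b : L × L, assocOf (Kn2mul σ η μ) a b c = 0}
        = {p : L × L | p.2 = 0} ∧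
    ¬ {p : L × L | p.2 = 0} ⊆
        {a : L × L | ∀ b c : L × L, assocOf (Kn2mul σ η μ) a b c = 0} := by
  obtain ⟨x, hx⟩ := exists_inv_apply_sub_ne_zero hσ h
  refine ⟨Set.ext fun b => ⟨fun hb => ?_, ?_⟩, Set.ext fun c => ⟨fun hc => ?_, ?_⟩, fun hl => ?_⟩
  · have hb := hb (x, 0) (0, 1)
    rw [assocOf_Kn2mul_left_inl_right] at hb
    simp only [Prod.mk_eq_zero, mul_eq_zero, EmbeddingLike.map_eq_zero_iff] at hb
    simp only [Set.mem_ofPred_eq]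
    tauto
  · obtain ⟨u, v⟩ := b
    rintro rfl
    exact assocOf_Kn2mul_middle_inl σ η μ u
  · have hc := hc (x, 0) (0, 1)
    rw [assocOf_Kn2mul_left_inl] at hc
    simp only [Prod.mk_eq_zero, mul_eq_zero, EmbeddingLike.map_eq_zero_iff] at hc
    simp only [Set.mem_ofPred_eq]
    tauto
  · obtain ⟨w, z⟩ := c
    rintro rfl
    exact assocOf_Kn2mul_right_inl σ η μ w
  · have hxx := hl (show ((x, 0) : L × L).2 = 0 from rfl) (0, 1) (0, 1)
    rw [assocOf_Kn2mul_left_inl] at hxx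
    simp only [Prod.mk_eq_zero, mul_eq_zero, map_one, one_ne_zero] at hxx
    tauto
end

section
/- Let A = Kn3(L, σ, η, μ) with η ≠ 0, and suppose that σ² ≠ Id or μ ≠ 0. Then the left nucleus and the right nucleus of A are both equal to L ⊕ 0, while L ⊕ 0 is not contained in the middle nucleus of A. -/
variable {F L : Type*} [Field F] [Field L] [Algebra F L]

/-- The associator of the `Kn₃` multiplication with an element of `L ⊕ 0` in the middle. -/
theorem assocOf_Kn3mul_middle (σ : L ≃ₐ[F] L) (η μ : L) (a c : L × L) (s : L) :
    assocOf (Kn3mul σ η μ) a (s, 0) c =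
      (η * a.2 * σ⁻¹ c.2 * (σ s - σ⁻¹ s), μ * a.2 * c.2 * (σ s - s)) := by
  ext <;> simp [assocOf, Kn3mul] <;> ring

/-- `L ⊕ 0` is contained in the left nucleus of `Kn₃`. -/
theorem assocOf_Kn3mul_left (σ : L ≃ₐ[F] L) (η μ : L) (b c : L × L) (x : L) :
    assocOf (Kn3mul σ η μ) (x, 0) b c = 0 := by
  ext <;> simp [assocOf, Kn3mul] <;> ring

/-- `L ⊕ 0` is contained in the right nucleus of `Kn₃`. -/
theorem assocOf_Kn3mul_right (σ : L ≃ₐ[F] L) (η μ : L) (a b : L × L) (u : L) :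
    assocOf (Kn3mul σ η μ) a b (u, 0) = 0 := by
  ext <;> simp [assocOf, Kn3mul, AlgEquiv.aut_inv] <;> ring

/-- Two elements outside `L ⊕ 0` cannot associate with all of `L ⊕ 0` in the middle. -/
theorem exists_assocOf_Kn3mul_middle_ne_zero (σ : L ≃ₐ[F] L) (hσ : σ ≠ 1) {η μ : L}
    (hη : η ≠ 0) (h : σ ^ 2 ≠ 1 ∨ μ ≠ 0) {a c : L × L} (ha : a.2 ≠ 0) (hc : c.2 ≠ 0) :
    ∃ s : L, assocOf (Kn3mul σ η μ) a (s, 0) c ≠ 0 := by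
  by_contra! H
  simp only [assocOf_Kn3mul_middle, Prod.mk_eq_zero, mul_eq_zero, hη, ha, hc, false_or, or_false,
    map_eq_zero, sub_eq_zero] at H
  rcases h with h | h
  · refine h (AlgEquiv.ext fun s => ?_)
    rw [pow_two, AlgEquiv.mul_apply, (H s).1, AlgEquiv.aut_inv, AlgEquiv.apply_symm_apply,
      AlgEquiv.one_apply]
  · exact hσ (AlgEquiv.ext fun s => (H s).2.resolve_left h)

/-- for `A = Kn₃(L,σ,η,μ)` with `η ≠ 0` and (`σ² ≠ Id` or `μ ≠ 0`),
the left and right nuclei of `A` equal `L ⊕ 0`, while `L ⊕ 0` is not contained in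
the middle nucleus of `A`. -/
theorem kn3_nuclei
    [FiniteDimensional F L] [Algebra.IsSeparable F L]
    (σ : L ≃ₐ[F] L) (hσ : σ ≠ 1) (η μ : L) (hη : η ≠ 0)
    (h : σ ^ 2 ≠ 1 ∨ μ ≠ 0) :
    {a : L × L | ∀ b c : L × L, assocOf (Kn3mul σ η μ) a b c = 0}
        = {p : L × L | p.2 = 0} ∧
    {c : L × L | ∀ a b : L × L, assocOf (Kn3mul σ η μ) a b c = 0}
        = {p : L × L | p.2 = 0} ∧
    ¬ {p : L × L | p.2 = 0} ⊆
        {b : L × L | ∀ a c : L × L, assocOf (Kn3mul σ η μ) a b c = 0} := by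
  refine ⟨Set.ext fun a => ⟨fun ha => ?_, fun ha b c => ?_⟩,
    Set.ext fun c => ⟨fun hc => ?_, fun hc a b => ?_⟩, fun hsub => ?_⟩
  · by_contra hne
    obtain ⟨s, hs⟩ := exists_assocOf_Kn3mul_middle_ne_zero (c := (0, 1)) σ hσ hη h hne one_ne_zero
    exact hs (ha _ _)
  · obtain ⟨x, y⟩ := a
    obtain rfl : y = 0 := ha
    exact assocOf_Kn3mul_left σ η μ b c x
  · by_contra hne
    obtain ⟨s, hs⟩ := exists_assocOf_Kn3mul_middle_ne_zero (a := (0, 1)) σ hσ hη h one_ne_zero hne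
    exact hs (hc _ _)
  · obtain ⟨u, v⟩ := c
    obtain rfl : v = 0 := hc
    exact assocOf_Kn3mul_right σ η μ a b u
  · obtain ⟨s, hs⟩ := exists_assocOf_Kn3mul_middle_ne_zero (a := (0, 1)) (c := (0, 1)) σ hσ hη h
      one_ne_zero one_ne_zero
    exact hs (hsub (show ((s, 0) : L × L).2 = 0 from rfl) _ _)
end

section
/- Let A = HK(L, σ, η, μ) with η ≠ 0, and suppose that σ² ≠ Id or μ ≠ 0. Then the left nucleus and the middle nucleus of A are both equal to L ⊕ 0, while L ⊕ 0 is not contained in the right nucleus of A. -/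
variable {F L : Type*} [Field F] [Field L] [Algebra F L]

theorem assocOf_HKmul_inl_right (σ : L ≃ₐ[F] L) (η μ c : L) (a b : L × L) :
    assocOf (HKmul σ η μ) a b (c, 0) =
      (a.2 * σ b.2) • (η * (c - σ (σ c)), μ * (σ c - σ (σ c))) := by
  ext <;> simp [assocOf, HKmul] <;> ring

theorem assocOf_HKmul_inl_left (σ : L ≃ₐ[F] L) (η μ : L) (a b c : L × L) (ha : a.2 = 0) :
    assocOf (HKmul σ η μ) a b c = 0 := by
  ext <;> simp [assocOf, HKmul, ha] <;> ring

theorem assocOf_HKmul_inl_middle (σ : L ≃ₐ[F] L) (η μ : L) (a b c : L × L) (hb : b.2 = 0) :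
    assocOf (HKmul σ η μ) a b c = 0 := by
  ext <;> simp [assocOf, HKmul, hb] <;> ring

/-- If `L ⊕ 0` associates on the right with `a` and `b`, then `a` or `b` lies in `L ⊕ 0`. -/
theorem snd_eq_zero_or_of_assocOf_HKmul_eq_zero (σ : L ≃ₐ[F] L) (hσ : σ ≠ 1) (η μ : L)
    (hη : η ≠ 0) (h : σ ^ 2 ≠ 1 ∨ μ ≠ 0) (a b : L × L)
    (hab : ∀ c : L, assocOf (HKmul σ η μ) a b (c, 0) = 0) : a.2 = 0 ∨ b.2 = 0 := by
  by_contra! hne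
  have hs : a.2 * σ b.2 ≠ 0 := mul_ne_zero hne.1 (by simpa using hne.2)
  have key : ∀ c : L, η * (c - σ (σ c)) = 0 ∧ μ * (σ c - σ (σ c)) = 0 := fun c => by
    have hc := hab c
    rw [assocOf_HKmul_inl_right] at hc
    simpa using (smul_eq_zero.mp hc).resolve_left hs
  rcases h with h | h
  · refine h (AlgEquiv.ext fun c => ?_)
    have hc := (mul_eq_zero.mp (key c).1).resolve_left hη
    simpa [pow_two] using (sub_eq_zero.mp hc).symm
  · refine hσ (AlgEquiv.ext fun c => σ.injective ?_)
    have hc := (mul_eq_zero.mp (key c).2).resolve_left h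
    simpa using (sub_eq_zero.mp hc).symm

/-- for `A = HK(L,σ,η,μ)` with `η ≠ 0` and (`σ² ≠ Id` or `μ ≠ 0`),
the left and middle nuclei of `A` equal `L ⊕ 0`, while `L ⊕ 0` is not contained in
the right nucleus of `A`. -/
theorem hk_nuclei
    [FiniteDimensional F L] [Algebra.IsSeparable F L]
    (σ : L ≃ₐ[F] L) (hσ : σ ≠ 1) (η μ : L) (hη : η ≠ 0)
    (h : σ ^ 2 ≠ 1 ∨ μ ≠ 0) :
    {a : L × L | ∀ b c : L × L, assocOf (HKmul σ η μ) a b c = 0}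
        = {p : L × L | p.2 = 0} ∧
    {b : L × L | ∀ a c : L × L, assocOf (HKmul σ η μ) a b c = 0}
        = {p : L × L | p.2 = 0} ∧
    ¬ {p : L × L | p.2 = 0} ⊆
        {c : L × L | ∀ a b : L × L, assocOf (HKmul σ η μ) a b c = 0} := by
  have key := snd_eq_zero_or_of_assocOf_HKmul_eq_zero σ hσ η μ hη h
  refine ⟨Set.ext fun p => ⟨fun hp => ?_, fun hp b c => ?_⟩,
    Set.ext fun p => ⟨fun hp => ?_, fun hp a c => ?_⟩, fun hsub => ?_⟩
  · exact (key p (0, 1) fun c => hp _ _).resolve_right one_ne_zero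
  · exact assocOf_HKmul_inl_left σ η μ p b c hp
  · exact (key (0, 1) p fun c => hp _ _).resolve_left one_ne_zero
  · exact assocOf_HKmul_inl_middle σ η μ a p c hp
  · have hkey := key (0, 1) (0, 1) fun c => hsub (show ((c, 0) : L × L).2 = 0 from rfl) _ _
    simp at hkey
end

section
/- Let A = Kn1(L, σ, η, μ) with η ≠ 0, and suppose that σ² ≠ Id or μ ≠ 0. Then L ⊕ 0 is not contained in the left nucleus of A, not contained in the middle nucleus of A, and not contained in the right nucleus of A. -/
variable {F L : Type*} [Field F] [Field L] [Algebra F L]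

/-- If `σ ≠ 1`, `σ ∘ σ` fixes every element and `μ = 0` or `σ l = l` for each `l`, then
`σ ^ 2 = 1` and `μ = 0`. -/
theorem sq_eq_one_and_eq_zero_of_fixed (σ : L ≃ₐ[F] L) (hσ : σ ≠ 1) (μ : L)
    (h₁ : ∀ l, σ (σ l) = l) (h₂ : ∀ l, μ = 0 ∨ σ l = l) : σ ^ 2 = 1 ∧ μ = 0 := by
  refine ⟨AlgEquiv.ext fun l => by simp [pow_two, h₁], ?_⟩
  by_contra hμ
  exact hσ (AlgEquiv.ext fun l => by simpa using (h₂ l).resolve_left hμ)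

/-- for `A = Kn₁(L,σ,η,μ)` with `η ≠ 0` and (`σ² ≠ Id` or `μ ≠ 0`),
`L ⊕ 0` is contained in none of the left, middle and right nuclei of `A`. -/
theorem kn1_nuclei
    [FiniteDimensional F L] [Algebra.IsSeparable F L]
    (σ : L ≃ₐ[F] L) (hσ : σ ≠ 1) (η μ : L) (hη : η ≠ 0)
    (h : σ ^ 2 ≠ 1 ∨ μ ≠ 0) :
    (¬ {p : L × L | p.2 = 0} ⊆
        {a : L × L | ∀ b c : L × L, assocOf (Kn1mul σ η μ) a b c = 0}) ∧
    (¬ {p : L × L | p.2 = 0} ⊆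
        {b : L × L | ∀ a c : L × L, assocOf (Kn1mul σ η μ) a b c = 0}) ∧
    (¬ {p : L × L | p.2 = 0} ⊆
        {c : L × L | ∀ a b : L × L, assocOf (Kn1mul σ η μ) a b c = 0}) := by
  have key : ¬ ((∀ l, σ (σ l) = l) ∧ ∀ l, μ = 0 ∨ σ l = l) := fun ⟨h₁, h₂⟩ =>
    have h' := sq_eq_one_and_eq_zero_of_fixed σ hσ μ h₁ h₂
    h.elim (· h'.1) (· h'.2)
  have inv_apply (l : L) : σ⁻¹ (σ l) = l := σ.symm_apply_apply l
  refine ⟨fun H => key ?_, fun H => key ?_, fun H => key ?_⟩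
  · have H' (l : L) := H (show ((l, 0) : L × L) ∈ _ from rfl) (0, 1) (0, 1)
    simp only [assocOf, Kn1mul, Prod.ext_iff, map_zero, map_one, mul_zero, zero_mul,
      mul_one, one_mul, add_zero, zero_add, sub_eq_zero] at H'
    refine ⟨fun l => ?_, fun l => ?_⟩
    · have e := (H' (σ (σ l))).1
      rw [inv_apply, inv_apply, mul_comm] at e
      exact (mul_right_cancel₀ hη e).symm
    · have e := (H' (σ l)).2
      rw [inv_apply] at e
      exact (mul_eq_mul_left_iff.mp e).symm.imp_right Eq.symm
  · have H' (l : L) := H (show ((l, 0) : L × L) ∈ _ from rfl) (0, 1) (0, 1)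
    simp only [assocOf, Kn1mul, Prod.ext_iff, map_zero, map_one, mul_zero, zero_mul,
      mul_one, one_mul, add_zero, zero_add, sub_eq_zero, inv_apply] at H'
    refine ⟨fun l => ?_, fun l => ?_⟩
    · have e := (H' (σ l)).1
      rw [inv_apply] at e
      exact (mul_left_cancel₀ hη e).symm
    · exact (mul_eq_mul_left_iff.mp (H' l).2).symm.imp_right Eq.symm
  · have H' (l : L) := H (show ((l, 0) : L × L) ∈ _ from rfl) (0, 1) (0, 1)
    simp only [assocOf, Kn1mul, Prod.ext_iff, map_zero, map_one, mul_zero, zero_mul,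
      mul_one, one_mul, add_zero, zero_add, sub_eq_zero] at H'
    refine ⟨fun l => (mul_left_cancel₀ hη (H' l).1).symm, fun l => ?_⟩
    exact (mul_eq_mul_left_iff.mp (H' l).2).symm.imp_right fun e => (σ.injective e).symm
end

section
/- Let F be a field, L/F a finite separable field extension, σ a nontrivial F-automorphism of L, and η, μ ∈ L with η ≠ 0. If σ² ≠ Id or μ ≠ 0, then the four algebras Kn1(L,σ,η,μ), Kn2(L,σ,η,μ), Kn3(L,σ,η,μ) and HK(L,σ,η,μ) are pairwise non-isomorphic as F-algebras. -/
variable {F L : Type*} [Field F] [Field L] [Algebra F L]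

/-- There is an `F`-algebra isomorphism between the (possibly nonassociative) algebras
on `L × L` with multiplications `m₁` and `m₂` and common unit `(1,0)`. -/
def NAIso (F : Type*) {L : Type*} [Field F] [Field L] [Algebra F L]
    (m₁ m₂ : L × L → L × L → L × L) : Prop :=
  ∃ e : (L × L) ≃ₗ[F] (L × L),
    (∀ p q : L × L, e (m₁ p q) = m₂ (e p) (e q)) ∧
    e ((1 : L), (0 : L)) = ((1 : L), (0 : L))

/-- The common shape of the four multiplications, with the twists of the product of the second
components left arbitrary. -/
def twistedMul (σ α β γ δ : L ≃ₐ[F] L) (η μ : L) (p q : L × L) : L × L :=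
  (p.1 * q.1 + η * α q.2 * β p.2,
   q.2 * p.1 + p.2 * σ q.1 + μ * γ q.2 * δ p.2)

/-- The left nucleus of a multiplication. -/
def leftNucleus {A : Type*} (m : A → A → A) : Set A :=
  {p | ∀ q r, m (m p q) r = m p (m q r)}

/-- The middle nucleus of a multiplication. -/
def middleNucleus {A : Type*} (m : A → A → A) : Set A :=
  {q | ∀ p r, m (m p q) r = m p (m q r)}

/-- The right nucleus of a multiplication. -/
def rightNucleus {A : Type*} (m : A → A → A) : Set A :=
  {r | ∀ p q, m (m p q) r = m p (m q r)}

theorem map_mem_leftNucleus {A B : Type*} {m₁ : A → A → A} {m₂ : B → B → B} (e : A ≃ B)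
    (he : ∀ p q, e (m₁ p q) = m₂ (e p) (e q)) {p : A} (h : p ∈ leftNucleus m₁) :
    e p ∈ leftNucleus m₂ := by
  intro q r
  obtain ⟨q, rfl⟩ := e.surjective q
  obtain ⟨r, rfl⟩ := e.surjective r
  simp only [← he, h q r]

theorem map_mem_middleNucleus {A B : Type*} {m₁ : A → A → A} {m₂ : B → B → B} (e : A ≃ B)
    (he : ∀ p q, e (m₁ p q) = m₂ (e p) (e q)) {q : A} (h : q ∈ middleNucleus m₁) :
    e q ∈ middleNucleus m₂ := by
  intro p r
  obtain ⟨p, rfl⟩ := e.surjective p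
  obtain ⟨r, rfl⟩ := e.surjective r
  simp only [← he, h p r]

theorem map_mem_rightNucleus {A B : Type*} {m₁ : A → A → A} {m₂ : B → B → B} (e : A ≃ B)
    (he : ∀ p q, e (m₁ p q) = m₂ (e p) (e q)) {r : A} (h : r ∈ rightNucleus m₁) :
    e r ∈ rightNucleus m₂ := by
  intro p q
  obtain ⟨p, rfl⟩ := e.surjective p
  obtain ⟨q, rfl⟩ := e.surjective q
  simp only [← he, h p q]

/-- A linear automorphism of `L × L` mapping `L × 0` into itself maps it onto itself. -/
theorem exists_apply_inl_eq [FiniteDimensional F L] (e : (L × L) ≃ₗ[F] (L × L))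
    (he : ∀ a : L, (e (a, 0)).2 = 0) (a : L) : ∃ b : L, e (b, 0) = (a, 0) := by
  let f : L →ₗ[F] L := LinearMap.fst F L L ∘ₗ e.toLinearMap ∘ₗ LinearMap.inl F L L
  have hf : ∀ b, e (b, 0) = (f b, 0) := fun b => Prod.ext rfl (he b)
  have hinj : Function.Injective f := by
    intro b c hbc
    have := e.injective ((hf b).trans ((congrArg (·, (0 : L)) hbc).trans (hf c).symm))
    exact congrArg Prod.fst this
  obtain ⟨b, hb⟩ := LinearMap.injective_iff_surjective.mp hinj a
  exact ⟨b, by rw [hf, hb]⟩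

/-- Suppose `e` carries `N₁` into `N₂` and `P₁` into `P₂`. If `N₁` and `P₁` contain `L × 0` and
`N₂` is contained in `L × 0`, then `P₂` contains `L × 0`. -/
theorem inl_mem_of_pinned [FiniteDimensional F L] (e : (L × L) ≃ₗ[F] (L × L))
    {N₁ N₂ P₁ P₂ : Set (L × L)} (hN : ∀ {p}, p ∈ N₁ → e p ∈ N₂) (hP : ∀ {p}, p ∈ P₁ → e p ∈ P₂)
    (hN₁ : ∀ a : L, (a, (0 : L)) ∈ N₁) (hN₂ : ∀ p ∈ N₂, p.2 = 0)
    (hP₁ : ∀ a : L, (a, (0 : L)) ∈ P₁) (a : L) : (a, (0 : L)) ∈ P₂ := by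
  obtain ⟨b, hb⟩ := exists_apply_inl_eq e (fun a => hN₂ _ (hN (hN₁ a))) a
  exact hb ▸ hP (hP₁ b)

theorem NAIso.symm {m₁ m₂ : L × L → L × L → L × L} (h : NAIso F m₁ m₂) : NAIso F m₂ m₁ := by
  obtain ⟨e, he, h1⟩ := h
  refine ⟨e.symm, fun p q => ?_, ?_⟩
  · rw [LinearEquiv.symm_apply_eq, he]
    simp
  · rw [LinearEquiv.symm_apply_eq, h1]

section TwistedMul

variable {σ α β γ δ : L ≃ₐ[F] L} {η μ : L}

theorem inl_mem_leftNucleus (hβ : ∀ x, β x = x) (hδ : ∀ x, μ * δ x = μ * x) (a : L) :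
    (a, (0 : L)) ∈ leftNucleus (twistedMul σ α β γ δ η μ) := by
  rintro ⟨x, y⟩ ⟨u, v⟩
  have := hδ a
  ext <;> simp [twistedMul, hβ] <;> grind

theorem inl_mem_middleNucleus (hβ : ∀ x, β (σ x) = α x) (hδ : ∀ x, μ * δ (σ x) = μ * γ x)
    (a : L) : (a, (0 : L)) ∈ middleNucleus (twistedMul σ α β γ δ η μ) := by
  rintro ⟨x, y⟩ ⟨u, v⟩
  have := hδ a
  ext <;> simp [twistedMul, hβ] <;> grind

theorem inl_mem_rightNucleus (hα : ∀ x, α (σ x) = x) (hγ : ∀ x, μ * γ (σ x) = μ * σ x)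
    (a : L) : (a, (0 : L)) ∈ rightNucleus (twistedMul σ α β γ δ η μ) := by
  rintro ⟨x, y⟩ ⟨u, v⟩
  have := hγ a
  ext <;> simp [twistedMul, hα] <;> grind

theorem middle_twists_of_inl_mem (hη : η ≠ 0)
    (h : ∀ a : L, (a, (0 : L)) ∈ middleNucleus (twistedMul σ α β γ δ η μ)) (x : L) :
    β (σ x) = α x ∧ μ * δ (σ x) = μ * γ x := by
  simpa [twistedMul, hη] using h x (0, 1) (0, 1)

theorem right_twists_of_inl_mem (hη : η ≠ 0)
    (h : ∀ a : L, (a, (0 : L)) ∈ rightNucleus (twistedMul σ α β γ δ η μ)) (x : L) :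
    α (σ x) = x ∧ μ * γ (σ x) = μ * σ x := by
  have := h x (0, 1) (0, 1)
  simp [twistedMul, hη] at this
  grind

theorem right_twists_of_mem_leftNucleus (hη : η ≠ 0) {p : L × L}
    (h : p ∈ leftNucleus (twistedMul σ α β γ δ η μ)) (hp : p.2 ≠ 0) (x : L) :
    α (σ x) = x ∧ μ * γ (σ x) = μ * σ x := by
  have := h (0, 1) (x, 0)
  simp [twistedMul, add_mul] at this
  grind [map_ne_zero_iff β β.injective, map_ne_zero_iff δ δ.injective]

theorem right_twists_of_mem_middleNucleus (hη : η ≠ 0) {p : L × L}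
    (h : p ∈ middleNucleus (twistedMul σ α β γ δ η μ)) (hp : p.2 ≠ 0) (x : L) :
    α (σ x) = x ∧ μ * γ (σ x) = μ * σ x := by
  have := h (0, 1) (x, 0)
  simp [twistedMul, add_mul] at this
  grind [map_ne_zero_iff α α.injective, map_ne_zero_iff γ γ.injective]

theorem middle_twists_of_mem_rightNucleus (hη : η ≠ 0) {p : L × L}
    (h : p ∈ rightNucleus (twistedMul σ α β γ δ η μ)) (hp : p.2 ≠ 0) (x : L) :
    β (σ x) = α x ∧ μ * δ (σ x) = μ * γ x := by
  have := h (0, 1) (x, 0)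
  simp [twistedMul] at this
  grind [map_ne_zero_iff α α.injective, map_ne_zero_iff γ γ.injective]

end TwistedMul

theorem false_of_involutive_of_mul_apply_eq {σ : L ≃ₐ[F] L} (hσ : σ ≠ 1) {μ : L}
    (h : σ ^ 2 ≠ 1 ∨ μ ≠ 0) (h₁ : ∀ x, σ (σ x) = x) (h₂ : ∀ x, μ * σ x = μ * x) : False := by
  rcases h with h | h
  · exact h (AlgEquiv.ext fun x => by simpa [pow_two] using h₁ x)
  · exact hσ (AlgEquiv.ext fun x => mul_left_cancel₀ h (h₂ x))

/-- if `σ² ≠ Id` or `μ ≠ 0` (and `η ≠ 0`), the four algebras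
`Kn₁(L,σ,η,μ)`, `Kn₂(L,σ,η,μ)`, `Kn₃(L,σ,η,μ)` and `HK(L,σ,η,μ)` are pairwise
non-isomorphic as `F`-algebras. -/
theorem knuth_hughesKleinfeld_pairwise_nonisomorphic
    [FiniteDimensional F L] [Algebra.IsSeparable F L]
    (σ : L ≃ₐ[F] L) (hσ : σ ≠ 1) (η μ : L) (hη : η ≠ 0)
    (h : σ ^ 2 ≠ 1 ∨ μ ≠ 0) :
    ¬ NAIso F (Kn1mul σ η μ) (Kn2mul σ η μ) ∧
    ¬ NAIso F (Kn1mul σ η μ) (Kn3mul σ η μ) ∧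
    ¬ NAIso F (Kn1mul σ η μ) (HKmul σ η μ) ∧
    ¬ NAIso F (Kn2mul σ η μ) (Kn3mul σ η μ) ∧
    ¬ NAIso F (Kn2mul σ η μ) (HKmul σ η μ) ∧
    ¬ NAIso F (Kn3mul σ η μ) (HKmul σ η μ) := by
  have hσi : ∀ x, σ⁻¹ (σ x) = x := σ.symm_apply_apply
  have hK1 : Kn1mul σ η μ = twistedMul σ σ (σ⁻¹ * σ⁻¹) σ σ⁻¹ η μ := rfl
  have hK2 : Kn2mul σ η μ = twistedMul σ σ⁻¹ (σ⁻¹ * σ⁻¹) 1 σ⁻¹ η μ := rfl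
  have hK3 : Kn3mul σ η μ = twistedMul σ σ⁻¹ 1 1 1 η μ := rfl
  have hHK : HKmul σ η μ = twistedMul σ σ 1 σ 1 η μ := rfl
  have hF := fun h₁ h₂ => false_of_involutive_of_mul_apply_eq hσ h h₁ h₂
  have not_right : ¬ ∀ x, σ (σ x) = x ∧ μ * σ (σ x) = μ * σ x := fun H =>
    hF (fun x => (H x).1) fun x => by rw [← (H x).2, (H x).1]
  have not_middle_Kn1 : ¬ ∀ x, σ⁻¹ (σ⁻¹ (σ x)) = σ x ∧ μ * σ⁻¹ (σ x) = μ * σ x := fun H =>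
    hF (fun x => by rw [← (H x).1, hσi]; exact σ.apply_symm_apply x)
      fun x => by rw [← (H x).2, hσi]
  have not_middle_Kn3 : ¬ ∀ x, σ x = σ⁻¹ x ∧ μ * σ x = μ * x := fun H =>
    hF (fun x => by rw [(H x).1]; exact σ.apply_symm_apply x) fun x => (H x).2
  have right2 := inl_mem_rightNucleus (σ := σ) (α := σ⁻¹) (β := σ⁻¹ * σ⁻¹) (γ := 1)
    (δ := σ⁻¹) (η := η) (μ := μ) hσi fun _ => rfl
  have right3 := inl_mem_rightNucleus (σ := σ) (α := σ⁻¹) (β := 1) (γ := 1)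
    (δ := 1) (η := η) (μ := μ) hσi fun _ => rfl
  have middle2 := inl_mem_middleNucleus (σ := σ) (α := σ⁻¹) (β := σ⁻¹ * σ⁻¹) (γ := 1)
    (δ := σ⁻¹) (η := η) (μ := μ) (fun x => congrArg _ (hσi x)) fun x => congrArg _ (hσi x)
  have middleHK := inl_mem_middleNucleus (σ := σ) (α := σ) (β := 1) (γ := σ)
    (δ := 1) (η := η) (μ := μ) (fun _ => rfl) fun _ => rfl
  have left3 := inl_mem_leftNucleus (σ := σ) (α := σ⁻¹) (β := 1) (γ := 1)
    (δ := 1) (η := η) (μ := μ) (fun _ => rfl) fun _ => rfl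
  have leftHK := inl_mem_leftNucleus (σ := σ) (α := σ) (β := 1) (γ := σ)
    (δ := 1) (η := η) (μ := μ) (fun _ => rfl) fun _ => rfl
  rw [hK1, hK2, hK3, hHK]
  refine ⟨fun H => ?_, fun H => ?_, fun H => ?_, fun H => ?_, fun H => ?_, fun H => ?_⟩
  · obtain ⟨e, he, -⟩ := H.symm
    exact not_right (right_twists_of_inl_mem hη (inl_mem_of_pinned e
      (map_mem_middleNucleus e.toEquiv he) (map_mem_rightNucleus e.toEquiv he) middle2
      (fun p hp => by_contra fun hp0 => not_right (right_twists_of_mem_middleNucleus hη hp hp0)) right2))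
  · obtain ⟨e, he, -⟩ := H.symm
    exact not_right (right_twists_of_inl_mem hη (inl_mem_of_pinned e
      (map_mem_rightNucleus e.toEquiv he) (map_mem_rightNucleus e.toEquiv he) right3
      (fun p hp => by_contra fun hp0 => not_middle_Kn1 (middle_twists_of_mem_rightNucleus hη hp hp0)) right3))
  · obtain ⟨e, he, -⟩ := H.symm
    exact not_middle_Kn1 (middle_twists_of_inl_mem hη (inl_mem_of_pinned e
      (map_mem_leftNucleus e.toEquiv he) (map_mem_middleNucleus e.toEquiv he) leftHK
      (fun p hp => by_contra fun hp0 => not_right (right_twists_of_mem_leftNucleus hη hp hp0)) middleHK))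
  · obtain ⟨e, he, -⟩ := H
    exact not_middle_Kn3 (middle_twists_of_inl_mem hη (inl_mem_of_pinned e
      (map_mem_rightNucleus e.toEquiv he) (map_mem_middleNucleus e.toEquiv he) right2
      (fun p hp => by_contra fun hp0 => not_middle_Kn3 (middle_twists_of_mem_rightNucleus hη hp hp0)) middle2))
  · obtain ⟨e, he, -⟩ := H
    exact not_right (right_twists_of_inl_mem hη (inl_mem_of_pinned e
      (map_mem_middleNucleus e.toEquiv he) (map_mem_rightNucleus e.toEquiv he) middle2
      (fun p hp => by_contra fun hp0 => not_right (right_twists_of_mem_middleNucleus hη hp hp0)) right2))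
  · obtain ⟨e, he, -⟩ := H
    exact not_right (right_twists_of_inl_mem hη (inl_mem_of_pinned e
      (map_mem_leftNucleus e.toEquiv he) (map_mem_rightNucleus e.toEquiv he) left3
      (fun p hp => by_contra fun hp0 => not_right (right_twists_of_mem_leftNucleus hη hp hp0)) right3))
end

section
/- Let A = HK(L, σ, η, μ) with η ≠ 0, and suppose that σ² ≠ Id or μ ≠ 0. Then a map φ : A → A is an F-algebra automorphism of A if and only if there exist τ ∈ Aut(L/F) commuting with σ and b ∈ L^× satisfying η b σ(b) = τ(η) and μ σ(b) = τ(μ), such that φ((x,y)) = (τ(x), τ(y) b) for all x, y ∈ L. -/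
variable {F L : Type*} [Field F] [Field L] [Algebra F L]

/-- The elements `(x, 0)` lie in the left nucleus of `HK`. -/
lemma HKmul_assoc_left (σ : L ≃ₐ[F] L) (η μ x : L) (p q : L × L) :
    HKmul σ η μ (HKmul σ η μ (x, 0) p) q = HKmul σ η μ (x, 0) (HKmul σ η μ p q) := by
  ext <;> simp [HKmul] <;> ring

/-- The left nucleus of `HK` is contained in `L ⊕ 0`. -/
lemma HKmul_snd_eq_zero_of_assoc (σ : L ≃ₐ[F] L) (hσ : σ ≠ 1) (η μ : L) (hη : η ≠ 0)
    (h : σ ^ 2 ≠ 1 ∨ μ ≠ 0) (r : L × L)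
    (hr : ∀ p q : L × L, HKmul σ η μ (HKmul σ η μ r p) q = HKmul σ η μ r (HKmul σ η μ p q)) :
    r.2 = 0 := by
  by_contra hb
  have key (v : L) := hr (0, 1) (v, 0)
  simp only [HKmul, Prod.mk.injEq, map_one, map_zero, mul_zero, mul_one, zero_mul, one_mul,
    zero_add, add_zero] at key
  have hsq (v : L) : σ (σ v) = v := by
    refine mul_left_cancel₀ (mul_ne_zero hη hb) ?_
    linear_combination -(key v).1
  rcases h with h | hμ
  · exact h (AlgEquiv.ext fun v => by simpa [pow_two] using hsq v)
  · refine hσ (AlgEquiv.ext fun v => ?_)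
    refine mul_left_cancel₀ (mul_ne_zero hμ hb) ?_
    have := (key v).2
    rw [hsq] at this
    simp only [AlgEquiv.one_apply]
    linear_combination this

/-- A multiplicative surjection of `HK` maps `L ⊕ 0` into itself. -/
lemma HKmul_map_snd_eq_zero (σ : L ≃ₐ[F] L) (hσ : σ ≠ 1) (η μ : L) (hη : η ≠ 0)
    (h : σ ^ 2 ≠ 1 ∨ μ ≠ 0) (φ : L × L → L × L) (hφ : Function.Surjective φ)
    (hmul : ∀ p q : L × L, φ (HKmul σ η μ p q) = HKmul σ η μ (φ p) (φ q)) (x : L) :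
    (φ (x, 0)).2 = 0 := by
  refine HKmul_snd_eq_zero_of_assoc σ hσ η μ hη h _ fun p q => ?_
  obtain ⟨p, rfl⟩ := hφ p
  obtain ⟨q, rfl⟩ := hφ q
  simp only [← hmul, HKmul_assoc_left]

/-- for `A = HK(L,σ,η,μ)` with `η ≠ 0` and (`σ² ≠ Id` or `μ ≠ 0`),
a map `φ : A → A` is an `F`-algebra automorphism of `A` if and only if it has the form
`(x,y) ↦ (τ(x), τ(y)b)` for some `τ ∈ Aut(L/F)` commuting with `σ` and some `b ∈ Lˣ`
with `η b σ(b) = τ(η)` and `μ σ(b) = τ(μ)`. -/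
theorem hk_automorphisms
    [FiniteDimensional F L] [Algebra.IsSeparable F L]
    (σ : L ≃ₐ[F] L) (hσ : σ ≠ 1) (η μ : L) (hη : η ≠ 0)
    (h : σ ^ 2 ≠ 1 ∨ μ ≠ 0) (φ : L × L → L × L) :
    (Function.Bijective φ ∧
        (∀ p q : L × L, φ (p + q) = φ p + φ q) ∧
        (∀ (c : F) (p : L × L), φ (c • p) = c • φ p) ∧
        (∀ p q : L × L, φ (HKmul σ η μ p q) = HKmul σ η μ (φ p) (φ q)) ∧
        φ ((1 : L), (0 : L)) = ((1 : L), (0 : L))) ↔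
      ∃ τ : L ≃ₐ[F] L, τ * σ = σ * τ ∧ ∃ b : L, b ≠ 0 ∧
        η * b * σ b = τ η ∧ μ * σ b = τ μ ∧
        ∀ x y : L, φ (x, y) = (τ x, τ y * b) := by
  constructor
  · rintro ⟨⟨hinj, hsurj⟩, hadd, hsmul, hmul, hone⟩
    have hL (x : L) : φ (x, 0) = ((φ (x, 0)).1, 0) :=
      Prod.ext rfl (HKmul_map_snd_eq_zero σ hσ η μ hη h φ hsurj hmul x)
    have hLadd (x y : L) : (φ (x + y, 0)).1 = (φ (x, 0)).1 + (φ (y, 0)).1 := by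
      simpa using congrArg Prod.fst (hadd (x, 0) (y, 0))
    have hLmul (x y : L) : (φ (x * y, 0)).1 = (φ (x, 0)).1 * (φ (y, 0)).1 := by
      have := congrArg Prod.fst (hmul (x, 0) (y, 0))
      rw [hL x, hL y] at this
      simpa [HKmul] using this
    have hLsmul (c : F) (x : L) : (φ (c • x, 0)).1 = c • (φ (x, 0)).1 := by
      simpa using congrArg Prod.fst (hsmul c (x, 0))
    let τ₀ : L →ₐ[F] L := AlgHom.ofLinearMap
      { toFun := fun x => (φ (x, 0)).1, map_add' := hLadd, map_smul' := hLsmul }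
      (by simp [hone]) hLmul
    let τ : L ≃ₐ[F] L := AlgEquiv.ofBijective τ₀ (Algebra.IsAlgebraic.algHom_bijective τ₀)
    have hτ (x : L) : φ (x, 0) = (τ x, 0) := hL x
    obtain ⟨a, b, hj⟩ : ∃ a b : L, φ (0, 1) = (a, b) := ⟨_, _, rfl⟩
    have hy (y : L) : φ (0, y) = (τ y * a, τ y * b) := by
      have := hmul (y, 0) (0, 1)
      rw [hτ, hj] at this
      simpa [HKmul, mul_comm] using this
    have hxy (x y : L) : φ (x, y) = (τ x + τ y * a, τ y * b) := by
      have := hadd (x, 0) (0, y)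
      rw [hτ, hy] at this
      simpa using this
    have hb : b ≠ 0 := by
      rintro rfl
      obtain ⟨⟨x, y⟩, h01⟩ := hsurj (0, 1)
      rw [hxy] at h01
      simpa using congrArg Prod.snd h01
    have hju (u : L) : τ (σ u) * a = a * τ u ∧ τ (σ u) * b = b * σ (τ u) := by
      have := hmul (0, 1) (u, 0)
      rw [hτ, hj] at this
      simpa [HKmul, hy] using this
    have hcomm (u : L) : τ (σ u) = σ (τ u) := by
      refine mul_right_cancel₀ hb ?_
      linear_combination (hju u).2
    have ha : a = 0 := by
      by_contra ha
      refine hσ (AlgEquiv.ext fun u => τ.injective (mul_right_cancel₀ ha ?_))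
      simp only [AlgEquiv.one_apply]
      linear_combination (hju u).1
    subst ha
    have hjj : τ η = η * σ b * b ∧ τ μ * b = μ * σ b * b := by
      have := hmul (0, 1) (0, 1)
      rw [hj] at this
      simpa [HKmul, hxy] using this
    refine ⟨τ, AlgEquiv.ext hcomm, b, hb, ?_, (mul_right_cancel₀ hb hjj.2).symm, fun x y => ?_⟩
    · rw [hjj.1]
      ring
    · simp [hxy]
  · rintro ⟨τ, hcomm, b, hb, hbη, hbμ, hφ⟩
    replace hcomm (u : L) : τ (σ u) = σ (τ u) := DFunLike.congr_fun hcomm u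
    refine ⟨⟨?_, ?_⟩, ?_, ?_, ?_, ?_⟩
    · rintro ⟨x, y⟩ ⟨u, v⟩ huv
      simpa [hφ, hb] using huv
    · rintro ⟨u, v⟩
      exact ⟨(τ.symm u, τ.symm (v * b⁻¹)), by simp [hφ, hb]⟩
    · rintro ⟨x, y⟩ ⟨u, v⟩
      simp [hφ, add_mul]
    · rintro c ⟨x, y⟩
      simp [hφ]
    · rintro ⟨x, y⟩ ⟨u, v⟩
      simp only [HKmul, hφ, map_add, map_mul, hcomm, ← hbη, ← hbμ, Prod.mk.injEq]
      constructor <;> ring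
    · simp [hφ]
end

section
/- Let G = Aut(L/F) and let C_G(σ) be the centraliser of σ in G. Let A be one of the algebras HK(L,σ,η,μ), Kn2(L,σ,η,μ) or Kn3(L,σ,η,μ), with η ≠ 0 and μ ≠ 0. Then the group of F-algebra automorphisms of A is isomorphic to the subgroup { τ ∈ C_G(σ) : τ( μ σ(μ) / σ(η) ) = μ σ(μ) / σ(η) } of C_G(σ). -/
variable {F L : Type*} [Field F] [Field L] [Algebra F L]

/-- The subgroup of `Aut(L/F)` consisting of those `τ` which commute with `σ` and
fix the element `d`. -/
def fixCentralizer {F L : Type*} [Field F] [Field L] [Algebra F L]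
    (σ : L ≃ₐ[F] L) (d : L) : Subgroup (L ≃ₐ[F] L) where
  carrier := {τ | τ * σ = σ * τ ∧ τ d = d}
  one_mem' := ⟨by rw [one_mul, mul_one], rfl⟩
  mul_mem' := by
    rintro τ₁ τ₂ ⟨hc1, hd1⟩ ⟨hc2, hd2⟩
    refine ⟨by rw [mul_assoc, hc2, ← mul_assoc, hc1, mul_assoc], ?_⟩
    show τ₁ (τ₂ d) = d
    rw [hd2, hd1]
  inv_mem' := by
    rintro τ ⟨hc, hd⟩
    refine ⟨?_, ?_⟩
    · rw [eq_comm, mul_inv_eq_iff_eq_mul, mul_assoc, ← hc, ← mul_assoc,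
        inv_mul_cancel, one_mul]
    · show τ.symm d = d
      conv_lhs => rw [← hd]
      exact τ.symm_apply_apply d

/-- An automorphism preserves the left nucleus. -/
theorem ntAut_left_nucleus {F M : Type*} [Field F] [AddCommGroup M] [Module F M]
    {mul : M → M → M} {one : M} {e : M ≃ₗ[F] M} (he : e ∈ ntAut F M mul one) {p : M}
    (hp : ∀ a b, mul (mul p a) b = mul p (mul a b)) (a b : M) :
    mul (mul (e p) a) b = mul (e p) (mul a b) := by
  obtain ⟨a, rfl⟩ := e.surjective a
  obtain ⟨b, rfl⟩ := e.surjective b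
  simp only [← he.1, hp]

/-- An automorphism preserves the right nucleus. -/
theorem ntAut_right_nucleus {F M : Type*} [Field F] [AddCommGroup M] [Module F M]
    {mul : M → M → M} {one : M} {e : M ≃ₗ[F] M} (he : e ∈ ntAut F M mul one) {p : M}
    (hp : ∀ a b, mul (mul a b) p = mul a (mul b p)) (a b : M) :
    mul (mul a b) (e p) = mul a (mul b (e p)) := by
  obtain ⟨a, rfl⟩ := e.surjective a
  obtain ⟨b, rfl⟩ := e.surjective b
  simp only [← he.1, hp]

theorem AlgEquiv.exists_apply_ne {σ : L ≃ₐ[F] L} (hσ : σ ≠ 1) : ∃ l, σ l ≠ l := by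
  by_contra! h
  exact hσ (AlgEquiv.ext h)

theorem HKmul_ntAut_snd_eq_zero
    {σ : L ≃ₐ[F] L} (hσ : σ ≠ 1) {η μ : L} (hη : η ≠ 0) (hμ : μ ≠ 0)
    {e : (L × L) ≃ₗ[F] L × L} (he : e ∈ ntAut F (L × L) (HKmul σ η μ) (1, 0)) (l : L) :
    (e (l, 0)).2 = 0 := by
  obtain ⟨m, hm⟩ := AlgEquiv.exists_apply_ne hσ
  have key := ntAut_left_nucleus he (p := (l, 0))
    (by intro a b; ext <;> simp [HKmul] <;> ring) (0, 1) (m, 0)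
  by_contra hy
  simp only [HKmul, Prod.mk.injEq, map_one, map_zero, mul_one, mul_zero, zero_mul, zero_add,
    add_zero, one_mul] at key
  obtain ⟨h1, h2⟩ := key
  have h3 : m = σ (σ m) := by
    apply mul_left_cancel₀ (mul_ne_zero hη hy)
    linear_combination h1
  have h4 : σ m = σ (σ m) := by
    apply mul_left_cancel₀ (mul_ne_zero hμ hy)
    linear_combination h2
  exact hm (h4.trans h3.symm)

theorem Kn3mul_ntAut_snd_eq_zero
    {σ : L ≃ₐ[F] L} (hσ : σ ≠ 1) {η μ : L} (hμ : μ ≠ 0)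
    {e : (L × L) ≃ₗ[F] L × L} (he : e ∈ ntAut F (L × L) (Kn3mul σ η μ) (1, 0)) (l : L) :
    (e (l, 0)).2 = 0 := by
  obtain ⟨m, hm⟩ := AlgEquiv.exists_apply_ne hσ
  have key := ntAut_left_nucleus he (p := (l, 0))
    (by intro a b; ext <;> simp [Kn3mul] <;> ring) (m, 0) (0, 1)
  by_contra hy
  simp only [Kn3mul, Prod.mk.injEq, map_one, map_zero, mul_one, mul_zero, zero_mul, zero_add,
    add_zero, one_mul] at key
  apply hm
  apply mul_left_cancel₀ (mul_ne_zero hμ hy)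
  linear_combination key.2

theorem Kn2mul_ntAut_snd_eq_zero
    {σ : L ≃ₐ[F] L} (hσ : σ ≠ 1) {η μ : L} (hμ : μ ≠ 0)
    {e : (L × L) ≃ₗ[F] L × L} (he : e ∈ ntAut F (L × L) (Kn2mul σ η μ) (1, 0)) (l : L) :
    (e (l, 0)).2 = 0 := by
  obtain ⟨m, hm⟩ := AlgEquiv.exists_apply_ne (inv_ne_one.mpr hσ)
  have key := ntAut_right_nucleus he (p := (l, 0))
    (by intro a b; ext <;> simp [Kn2mul] <;> ring) (m, 0) (0, 1)
  by_contra hy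
  simp only [Kn2mul, Prod.mk.injEq, map_one, map_zero, mul_one, mul_zero, zero_mul, zero_add,
    add_zero, one_mul] at key
  apply hm
  apply mul_left_cancel₀ (mul_ne_zero hμ hy)
  linear_combination key.2

/-- The `F`-linear equivalence `(x, y) ↦ (τ x, τ y * b)` of `L × L`. -/
def twistedProdEquiv (τ : L ≃ₐ[F] L) (b : L) (hb : b ≠ 0) : (L × L) ≃ₗ[F] L × L where
  toFun p := (τ p.1, τ p.2 * b)
  invFun p := (τ.symm p.1, τ.symm (p.2 * b⁻¹))
  map_add' p q := by simp [add_mul]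
  map_smul' c p := by simp
  left_inv p := by simp [hb]
  right_inv p := by simp [hb]

theorem twistedProdEquiv_apply (τ : L ≃ₐ[F] L) (b : L) (hb : b ≠ 0) (p : L × L) :
    twistedProdEquiv τ b hb p = (τ p.1, τ p.2 * b) := rfl

theorem AlgEquiv.commute_apply {σ τ ρ : L ≃ₐ[F] L} (h : τ * σ = σ * τ) (hρ : ρ ∈ Subgroup.zpowers σ) (x : L) :
    τ (ρ x) = ρ (τ x) := by
  obtain ⟨n, rfl⟩ := hρ
  exact DFunLike.congr_fun ((show Commute τ σ from h).zpow_right n).eq x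

/-- For a multiplication
`(x,y)(u,v) = (xu + η α(v) β(y), vx + y σ(u) + μ γ(v) δ(y))` on `L × L`, where
`α, β, γ, δ` are powers of `σ`, `γ(b) δ(b) = b ω(b)` and `α(b) β(b) = ω(b) σ⁻¹(ω(b))` for some
power `ω` of `σ`, such that every automorphism stabilises `L × 0`, the automorphism group is
the subgroup of the centraliser of `σ` fixing `μ σ(μ) / σ(η)`. -/
theorem nonempty_ntAut_mulEquiv_fixCentralizer [FiniteDimensional F L] {σ : L ≃ₐ[F] L} (hσ : σ ≠ 1) {η μ : L} (hη : η ≠ 0) (hμ : μ ≠ 0)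
    {mul : L × L → L × L → L × L} {α β γ δ ω : L ≃ₐ[F] L}
    (hα : α ∈ Subgroup.zpowers σ) (hβ : β ∈ Subgroup.zpowers σ) (hγ : γ ∈ Subgroup.zpowers σ)
    (hδ : δ ∈ Subgroup.zpowers σ) (hω : ω ∈ Subgroup.zpowers σ)
    (hmul : ∀ p q, mul p q =
      (p.1 * q.1 + η * α q.2 * β p.2, q.2 * p.1 + p.2 * σ q.1 + μ * γ q.2 * δ p.2))
    (hγδ : ∀ b, γ b * δ b = b * ω b) (hαβ : ∀ b, α b * β b = ω b * σ⁻¹ (ω b))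
    (hL : ∀ e ∈ ntAut F (L × L) mul (1, 0), ∀ l, (e (l, 0)).2 = 0) :
    Nonempty (↥(ntAut F (L × L) mul ((1 : L), (0 : L))) ≃*
      ↥(fixCentralizer σ (μ * σ μ / σ η))) := by
  have hση : σ η ≠ 0 := by simpa using hη
  have hσμ : σ μ ≠ 0 := by simpa using hμ
  have hb (τ : L ≃ₐ[F] L) : ω⁻¹ (τ μ / μ) ≠ 0 := by simp [hμ]
  have hωb (x : L) : ω (ω⁻¹ x) = x := ω.apply_symm_apply x
  have hσσ (x : L) : σ (σ⁻¹ x) = x := σ.apply_symm_apply x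
  have mem (τ : L ≃ₐ[F] L) (hτ : τ ∈ fixCentralizer σ (μ * σ μ / σ η)) :
      twistedProdEquiv τ (ω⁻¹ (τ μ / μ)) (hb τ) ∈ ntAut F (L × L) mul (1, 0) := by
    obtain ⟨hc, hd⟩ := hτ
    have h1 := hγδ (ω⁻¹ (τ μ / μ))
    have h2 := hαβ (ω⁻¹ (τ μ / μ))
    rw [hωb] at h1 h2
    have hσc : ∀ x, τ (σ x) = σ (τ x) :=
      AlgEquiv.commute_apply hc (Subgroup.mem_zpowers σ)
    have h3 : τ η = η * (τ μ / μ * σ⁻¹ (τ μ / μ)) := by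
      apply σ.injective
      have hτη : σ (τ η) ≠ 0 := by simpa using hη
      rw [map_mul, map_mul, hσσ, map_div₀]
      rw [map_div₀, map_mul, hσc, hσc] at hd
      field_simp at hd ⊢
      linear_combination -hd
    refine ⟨fun p q => ?_, ?_⟩
    · simp only [twistedProdEquiv_apply, hmul, map_add, map_mul, AlgEquiv.commute_apply hc hα,
        AlgEquiv.commute_apply hc hβ, AlgEquiv.commute_apply hc hγ, AlgEquiv.commute_apply hc hδ,
        hσc]
      ext
      · simp only [h3]
        linear_combination (-η * α (τ q.2) * β (τ p.2)) * h2
      · have h4 : τ μ = μ * (τ μ / μ) := by field_simp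
        linear_combination (-μ * γ (τ q.2) * δ (τ p.2)) * h1 +
          γ (τ q.2) * δ (τ p.2) * ω⁻¹ (τ μ / μ) * h4
    · simp [twistedProdEquiv_apply]
  let φ : ↥(fixCentralizer σ (μ * σ μ / σ η)) →* ↥(ntAut F (L × L) mul ((1 : L), (0 : L))) :=
    MonoidHom.mk' (fun τ => ⟨_, mem τ.1 τ.2⟩) (by
      rintro ⟨τ, hτ⟩ ⟨ρ, hρ⟩
      apply Subtype.ext
      apply LinearEquiv.ext
      intro p
      have h : ω⁻¹ ((τ * ρ) μ / μ) = τ (ω⁻¹ (ρ μ / μ)) * ω⁻¹ (τ μ / μ) := by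
        rw [AlgEquiv.commute_apply hτ.1 (inv_mem hω), ← map_mul]
        have : τ μ ≠ 0 := by simpa using hμ
        congr 1
        rw [map_div₀, AlgEquiv.mul_apply]
        field_simp
      show (τ (ρ p.1), τ (ρ p.2) * ω⁻¹ ((τ * ρ) μ / μ)) =
        (τ (ρ p.1), τ (ρ p.2 * ω⁻¹ (ρ μ / μ)) * ω⁻¹ (τ μ / μ))
      rw [h, map_mul, mul_assoc])
  refine ⟨(MulEquiv.ofBijective φ ⟨?_, ?_⟩).symm⟩
  · intro τ ρ h
    apply Subtype.ext
    apply AlgEquiv.ext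
    intro x
    exact congrArg (fun e => (e.1 (x, 0)).1) h
  · rintro ⟨e, he⟩
    have hL' (l : L) : e (l, 0) = ((e (l, 0)).1, 0) := Prod.ext rfl (hL e he l)
    let τ₀ : L →ₐ[F] L := AlgHom.ofLinearMap
      (LinearMap.fst F L L ∘ₗ e.toLinearMap ∘ₗ LinearMap.inl F L L)
      (congrArg Prod.fst he.2) (by
        intro x y
        have h := he.1 (x, 0) (y, 0)
        rw [hL' x, hL' y] at h
        simp only [hmul, map_zero, mul_zero, zero_mul, add_zero] at h
        exact congrArg Prod.fst h)
    let τ : L ≃ₐ[F] L := AlgEquiv.ofBijective τ₀ (Algebra.IsAlgebraic.algHom_bijective τ₀)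
    have hτ (l : L) : e (l, 0) = (τ l, 0) := hL' l
    obtain ⟨a, b, hab⟩ : ∃ a b, e (0, 1) = (a, b) := ⟨_, _, rfl⟩
    have he2 (y : L) : e (0, y) = (τ y * a, τ y * b) := by
      have h := he.1 (y, 0) (0, 1)
      rw [hτ, hab] at h
      simpa [hmul, mul_comm] using h
    have hb0 : b ≠ 0 := by
      rintro rfl
      obtain ⟨x, hx⟩ := τ.surjective a
      have h : e (x, 0) = e (0, 1) := by rw [hτ, hab, hx]
      simpa using e.injective h
    have hcomm (l : L) : a * τ l = τ (σ l) * a ∧ b * σ (τ l) = τ (σ l) * b := by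
      have h := he.1 (0, 1) (l, 0)
      rw [hτ, hab] at h
      simp only [hmul, map_zero, mul_zero, zero_mul, add_zero, zero_add, one_mul, he2,
        Prod.mk.injEq] at h
      exact ⟨h.1.symm, h.2.symm⟩
    have hστ (l : L) : τ (σ l) = σ (τ l) :=
      mul_right_cancel₀ hb0 (by rw [← (hcomm l).2, mul_comm])
    have ha : a = 0 := by
      obtain ⟨m, hm⟩ := AlgEquiv.exists_apply_ne hσ
      by_contra ha
      apply hm
      apply τ.injective
      exact mul_right_cancel₀ ha (by rw [← (hcomm m).1, mul_comm])
    subst ha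
    have hsplit (x y : L) : e (x, y) = (τ x, τ y * b) := by
      have : ((x, y) : L × L) = (x, 0) + (0, y) := by simp
      rw [this, map_add, hτ, he2]
      simp
    have hsq := he.1 (0, 1) (0, 1)
    simp only [hmul, hsplit, map_zero, map_one, mul_zero, mul_one, one_mul, zero_add, add_zero,
      Prod.mk.injEq] at hsq
    obtain ⟨h1, h2⟩ := hsq
    rw [mul_assoc, hαβ] at h1
    rw [mul_assoc, hγδ] at h2
    have h3 : τ μ / μ = ω b := by
      rw [div_eq_iff hμ]
      apply mul_right_cancel₀ hb0
      linear_combination h2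
    have h4 : ω⁻¹ (τ μ / μ) = b := by
      rw [h3]
      exact ω.symm_apply_apply b
    have hmem : τ ∈ fixCentralizer σ (μ * σ μ / σ η) := by
      refine ⟨AlgEquiv.ext hστ, ?_⟩
      rw [div_eq_iff hμ] at h3
      have hωb0 : ω b ≠ 0 := by simpa using hb0
      have hσωb0 : σ (ω b) ≠ 0 := by simpa using hb0
      rw [map_div₀, map_mul, hστ, hστ, h1, h3]
      simp only [map_mul, hσσ]
      field_simp
    refine ⟨⟨τ, hmem⟩, ?_⟩
    apply Subtype.ext
    apply LinearEquiv.ext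
    rintro ⟨x, y⟩
    show (τ x, τ y * ω⁻¹ (τ μ / μ)) = e (x, y)
    rw [hsplit, h4]

/-- for `A` one of `HK(L,σ,η,μ)`, `Kn₂(L,σ,η,μ)`, `Kn₃(L,σ,η,μ)` with
`η ≠ 0` and `μ ≠ 0`, the automorphism group of `A` is isomorphic to the subgroup
`{τ ∈ C_G(σ) : τ(μσ(μ)/σ(η)) = μσ(μ)/σ(η)}` of the centraliser of `σ` in
`G = Aut(L/F)`. -/
theorem hk_kn2_kn3_aut_group
    [FiniteDimensional F L] [Algebra.IsSeparable F L]
    (σ : L ≃ₐ[F] L) (hσ : σ ≠ 1) (η μ : L) (hη : η ≠ 0) (hμ : μ ≠ 0) :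
    Nonempty
      (↥(ntAut F (L × L) (HKmul σ η μ) ((1 : L), (0 : L))) ≃*
        ↥(fixCentralizer σ (μ * σ μ / σ η))) ∧
    Nonempty
      (↥(ntAut F (L × L) (Kn2mul σ η μ) ((1 : L), (0 : L))) ≃*
        ↥(fixCentralizer σ (μ * σ μ / σ η))) ∧
    Nonempty
      (↥(ntAut F (L × L) (Kn3mul σ η μ) ((1 : L), (0 : L))) ≃*
        ↥(fixCentralizer σ (μ * σ μ / σ η))) := by
  have hs : σ ∈ Subgroup.zpowers σ := Subgroup.mem_zpowers σ
  have hi := inv_mem hs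
  have h1 := one_mem (Subgroup.zpowers σ)
  refine ⟨?_, ?_, ?_⟩
  · exact nonempty_ntAut_mulEquiv_fixCentralizer hσ hη hμ (α := σ) (β := 1) (γ := σ) (δ := 1)
      (ω := σ) hs h1 hs h1 hs (fun _ _ => rfl) (fun b => mul_comm _ _)
      (fun b => congrArg (σ b * ·) (σ.symm_apply_apply b).symm)
      (fun _ he => HKmul_ntAut_snd_eq_zero hσ hη hμ he)
  · exact nonempty_ntAut_mulEquiv_fixCentralizer hσ hη hμ (α := σ⁻¹) (β := σ⁻¹ * σ⁻¹) (γ := 1)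
      (δ := σ⁻¹) (ω := σ⁻¹) hi (mul_mem hi hi) h1 hi hi (fun _ _ => rfl) (fun _ => rfl)
      (fun _ => rfl) (fun _ he => Kn2mul_ntAut_snd_eq_zero hσ hμ he)
  · exact nonempty_ntAut_mulEquiv_fixCentralizer hσ hη hμ (α := σ⁻¹) (β := 1) (γ := 1) (δ := 1)
      (ω := 1) hi h1 h1 h1 h1 (fun _ _ => rfl) (fun _ => rfl) (fun b => mul_comm _ _)
      (fun _ he => Kn3mul_ntAut_snd_eq_zero hσ hμ he)
end
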